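/- Suppose m ≥ n > 2 and A = i_1 i_2 ⋯ i_n ⊆ [m] with i_1 < i_2 < … < i_n. Set i_0 = −1 and d_ℓ = i_ℓ − (i_{ℓ−1} + 1) for ℓ = 1, …, n. Then the link of the vertex A in the Vietoris–Rips complex VR(F^m_{⪯A}, 2) is homotopy equivalent to a wedge sum of ( Σ_{k=2}^{n−2} (k choose 2) + Σ_{ℓ=1}^{n−2} d_ℓ · (n−ℓ choose 2) ) copies of the 2-sphere S². -/

import Mathlib

open Finset

/-- An abstract simplicial complex on a vertex type `V`: a collection of nonempty
finite subsets of `V` (the faces), closed under taking nonempty subsets. -/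
structure AbsSC (V : Type) where
  faces : Set (Finset V)
  not_empty_mem : ∅ ∉ faces
  down_closed : ∀ s ∈ faces, ∀ t : Finset V, t ⊆ s → t ≠ ∅ → t ∈ faces

namespace AbsSC

variable {V W : Type}

/-- The vertex set of a simplicial complex. -/
def vertices (K : AbsSC V) : Set V := {v | ({v} : Finset V) ∈ K.faces}

/-- The geometric realization of a simplicial complex: the space of convex weightings
supported on a face, topologized as a subspace of `V → ℝ`. -/
def space (K : AbsSC V) : Type :=
  {f : V → ℝ // (∀ v, 0 ≤ f v) ∧ ∃ s ∈ K.faces, (∀ v, f v ≠ 0 → v ∈ s) ∧ ∑ v ∈ s, f v = 1}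

instance (K : AbsSC V) : TopologicalSpace K.space := by unfold space; infer_instance

/-- `L` is a subcomplex of `K`. -/
def IsSubcomplex (L K : AbsSC V) : Prop := L.faces ⊆ K.faces

/-- Homotopy equivalence of simplicial complexes (of their geometric realizations). -/
def HEquiv (K : AbsSC V) (L : AbsSC W) : Prop :=
  Nonempty (ContinuousMap.HomotopyEquiv K.space L.space)

/-- The realization of `K` is homotopy equivalent to the topological space `X`. -/
def HEquivTop (K : AbsSC V) (X : Type) [TopologicalSpace X] : Prop :=
  Nonempty (ContinuousMap.HomotopyEquiv K.space X)

/-- The inclusion of realizations induced by a subcomplex inclusion. -/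
def incl {L K : AbsSC V} (h : L.faces ⊆ K.faces) : C(L.space, K.space) where
  toFun f := ⟨f.1, f.2.1, by obtain ⟨s, hs, h1, h2⟩ := f.2.2; exact ⟨s, h hs, h1, h2⟩⟩
  continuous_toFun := Continuous.subtype_mk continuous_subtype_val _

variable [DecidableEq V]

/-- The link of a vertex. -/
def link (K : AbsSC V) (v : V) : AbsSC V where
  faces := {σ | σ ≠ ∅ ∧ v ∉ σ ∧ σ ∪ {v} ∈ K.faces}
  not_empty_mem h := h.1 rfl
  down_closed := by
    rintro s ⟨hne, hv, hs⟩ t hts htne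
    exact ⟨htne, fun hvt => hv (hts hvt),
      K.down_closed _ hs _ (Finset.union_subset_union hts (Finset.Subset.refl _)) (by simp [Finset.union_eq_empty])⟩

lemma link_subset (K : AbsSC V) (v : V) : (K.link v).faces ⊆ K.faces := by
  rintro σ ⟨hne, hv, hσ⟩
  exact K.down_closed _ hσ _ Finset.subset_union_left hne

/-- The complex induced on the vertices other than `v`. -/
def delete (K : AbsSC V) (v : V) : AbsSC V where
  faces := {σ | σ ∈ K.faces ∧ v ∉ σ}
  not_empty_mem h := K.not_empty_mem h.1
  down_closed := by
    rintro s ⟨hs, hv⟩ t hts htne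
    exact ⟨K.down_closed _ hs _ hts htne, fun h => hv (hts h)⟩

/-- The star of a vertex: `st_K(v) = {σ : σ ∪ {v} ∈ K}`. -/
def star (K : AbsSC V) (v : V) : AbsSC V where
  faces := {σ | σ ≠ ∅ ∧ σ ∪ {v} ∈ K.faces}
  not_empty_mem h := h.1 rfl
  down_closed := by
    rintro s ⟨hne, hs⟩ t hts htne
    exact ⟨htne,
      K.down_closed _ hs _ (Finset.union_subset_union hts (Finset.Subset.refl _)) (by simp [Finset.union_eq_empty])⟩

/-- The star cluster of a subcomplex `L` in `K`: the union of stars of vertices of `L`. -/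
def starCluster (K L : AbsSC V) : AbsSC V where
  faces := {σ | σ ≠ ∅ ∧ ∃ v, ({v} : Finset V) ∈ L.faces ∧ σ ∪ {v} ∈ K.faces}
  not_empty_mem h := h.1 rfl
  down_closed := by
    rintro s ⟨hne, v, hvL, hs⟩ t hts htne
    exact ⟨htne, v, hvL,
      K.down_closed _ hs _ (Finset.union_subset_union hts (Finset.Subset.refl _)) (by simp [Finset.union_eq_empty])⟩

/-- The union of two simplicial complexes. -/
def union (K₁ K₂ : AbsSC V) : AbsSC V where
  faces := K₁.faces ∪ K₂.faces
  not_empty_mem h := by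
    rcases h with h | h
    exacts [K₁.not_empty_mem h, K₂.not_empty_mem h]
  down_closed := by
    rintro s (hs | hs) t hts htne
    exacts [Or.inl (K₁.down_closed _ hs _ hts htne), Or.inr (K₂.down_closed _ hs _ hts htne)]

/-- The union of a family of simplicial complexes. -/
def iUnionC {ι : Type} (F : ι → AbsSC V) : AbsSC V where
  faces := ⋃ i, (F i).faces
  not_empty_mem h := by
    obtain ⟨i, hi⟩ := Set.mem_iUnion.mp h
    exact (F i).not_empty_mem hi
  down_closed := by
    intro s hs t hts htne
    obtain ⟨i, hi⟩ := Set.mem_iUnion.mp hs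
    exact Set.mem_iUnion.mpr ⟨i, (F i).down_closed _ hi _ hts htne⟩

/-- The `n`-skeleton of a complex: all faces with at most `n+1` vertices. -/
def skeleton (K : AbsSC V) (n : ℕ) : AbsSC V where
  faces := {σ | σ ∈ K.faces ∧ σ.card ≤ n + 1}
  not_empty_mem h := K.not_empty_mem h.1
  down_closed := by
    rintro s ⟨hs, hcard⟩ t hts htne
    exact ⟨K.down_closed _ hs _ hts htne, le_trans (Finset.card_le_card hts) hcard⟩

/-- The simplicial complex generated by a single simplex `s` (all its nonempty subsets). -/
def simplexCx (s : Finset V) : AbsSC V where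
  faces := {t | t ≠ ∅ ∧ t ⊆ s}
  not_empty_mem h := h.1 rfl
  down_closed := by
    rintro a ⟨hne, has⟩ t hta htne
    exact ⟨htne, hta.trans has⟩

/-- A maximal simplex (facet) of `K`. -/
def IsFacet (K : AbsSC V) (σ : Finset V) : Prop :=
  σ ∈ K.faces ∧ ∀ τ ∈ K.faces, σ ⊆ τ → τ = σ

/-- `K` is a clique complex: any nonempty set of vertices which pairwise span edges is a face. -/
def IsCliqueCx (K : AbsSC V) : Prop :=
  ∀ σ : Finset V, σ ≠ ∅ → (∀ v ∈ σ, ({v} : Finset V) ∈ K.faces) →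
    (∀ v ∈ σ, ∀ w ∈ σ, v ≠ w → ({v, w} : Finset V) ∈ K.faces) → σ ∈ K.faces

/-- `L` is a full subcomplex of `K`. -/
def IsFull (L K : AbsSC V) : Prop :=
  ∀ σ ∈ K.faces, (∀ v ∈ σ, ({v} : Finset V) ∈ L.faces) → σ ∈ L.faces

end AbsSC

noncomputable section

/-- The `n`-dimensional sphere. -/
abbrev Sph (n : ℕ) : Type := Metric.sphere (0 : EuclideanSpace ℝ (Fin (n + 1))) 1

/-- A base point on the sphere. -/
def sphBase (n : ℕ) : Sph n :=
  ⟨EuclideanSpace.single 0 1, by simp⟩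

/-- Relation gluing the base points of `c` copies of a pointed space to an auxiliary point. -/
inductive wedgeRel (c : ℕ) (X : Type) (x₀ : X) : Unit ⊕ Fin c × X → Unit ⊕ Fin c × X → Prop
  | glue (i : Fin c) : wedgeRel c X x₀ (Sum.inl ()) (Sum.inr (i, x₀))

/-- The wedge sum of `c` copies of the pointed space `(X, x₀)`. -/
def Wedge (c : ℕ) (X : Type) [TopologicalSpace X] (x₀ : X) : Type := Quot (wedgeRel c X x₀)

instance (c : ℕ) (X : Type) [TopologicalSpace X] (x₀ : X) : TopologicalSpace (Wedge c X x₀) := by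
  unfold Wedge; infer_instance

/-- The base point of the wedge. -/
def wedgePt (c : ℕ) (X : Type) [TopologicalSpace X] (x₀ : X) : Wedge c X x₀ :=
  Quot.mk _ (Sum.inl ())

/-- The wedge sum of `c` copies of the `n`-sphere. -/
abbrev WedgeSph (n c : ℕ) : Type := Wedge c (Sph n) (sphBase n)

/-- The base point of a wedge of spheres. -/
def wedgeSphPt (n c : ℕ) : WedgeSph n c := wedgePt c _ _

/-- Relation gluing the two base points in a binary wedge. -/
inductive wedge2Rel (X Y : Type) (x₀ : X) (y₀ : Y) : X ⊕ Y → X ⊕ Y → Prop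
  | glue : wedge2Rel X Y x₀ y₀ (Sum.inl x₀) (Sum.inr y₀)

/-- The wedge sum `X ∨ Y` of two pointed spaces. -/
def Wedge2 (X Y : Type) [TopologicalSpace X] [TopologicalSpace Y] (x₀ : X) (y₀ : Y) : Type :=
  Quot (wedge2Rel X Y x₀ y₀)

instance (X Y : Type) [TopologicalSpace X] [TopologicalSpace Y] (x₀ : X) (y₀ : Y) :
    TopologicalSpace (Wedge2 X Y x₀ y₀) := by unfold Wedge2; infer_instance

/-- Relation collapsing the top and bottom of the cylinder `X × [0,1]` to two cone points. -/
inductive suspRel (X : Type) : X × unitInterval ⊕ Bool → X × unitInterval ⊕ Bool → Prop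
  | zero (x : X) : suspRel X (Sum.inl (x, 0)) (Sum.inr false)
  | one (x : X) : suspRel X (Sum.inl (x, 1)) (Sum.inr true)

/-- The (unreduced) suspension `Σ X`. -/
def Susp (X : Type) [TopologicalSpace X] : Type := Quot (suspRel X)

instance (X : Type) [TopologicalSpace X] : TopologicalSpace (Susp X) := by
  unfold Susp; infer_instance

/-- The north cone point of the suspension. -/
def suspNorth (X : Type) [TopologicalSpace X] : Susp X := Quot.mk _ (Sum.inr true)

end

/-- The Vietoris–Rips complex at scale `r` of a collection `F` of finite subsets of `ℕ`,
with respect to the symmetric difference metric `d(A,B) = |A Δ B|`. -/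
def VRc (F : Set (Finset ℕ)) (r : ℕ) : AbsSC (Finset ℕ) where
  faces := {σ | σ.Nonempty ∧ (∀ A ∈ σ, A ∈ F) ∧
    ∀ A ∈ σ, ∀ B ∈ σ, (symmDiff A B).card ≤ r}
  not_empty_mem h := by simpa using h.1
  down_closed := by
    rintro s ⟨hne, hF, hd⟩ t hts htne
    exact ⟨Finset.nonempty_iff_ne_empty.mpr htne, fun A hA => hF A (hts hA),
      fun A hA B hB => hd A (hts hA) B (hts hB)⟩

/-- `F_n^m`: all `n`-element subsets of `[m] = {1, …, m}`. -/
def Fnm (m n : ℕ) : Set (Finset ℕ) := {A | A ⊆ Finset.Icc 1 m ∧ A.card = n}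

/-- `F_{≤ n}^m`: all subsets of `[m]` of cardinality at most `n`. -/
def Fle (m n : ℕ) : Set (Finset ℕ) := {A | A ⊆ Finset.Icc 1 m ∧ A.card ≤ n}

/-- The simplex `N[C] = {A : C ⊆ A, |A \ C| = 1}` inside `[m]`. -/
def NSimp (m : ℕ) (C : Finset ℕ) : Finset (Finset ℕ) :=
  (Finset.Icc 1 m \ C).image (fun x => insert x C)

/-- The simplex `L[S]`: all subsets of `S` obtained by removing one element. -/
def LSimp (S : Finset ℕ) : Finset (Finset ℕ) := S.image (fun x => S.erase x)

/-- The total order `≺`: first compare cardinalities, then compare the increasing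
enumerations lexicographically. -/
def precLT (A B : Finset ℕ) : Prop :=
  A.card < B.card ∨
    (A.card = B.card ∧ List.Lex (· < ·) (A.sort (· ≤ ·)) (B.sort (· ≤ ·)))

/-- `A ⪯ B`. -/
def precLE (A B : Finset ℕ) : Prop := precLT A B ∨ A = B

/-- `F^m_{≺ A}`: all subsets of `[m]` strictly preceding `A`. -/
def FprecLT (m : ℕ) (A : Finset ℕ) : Set (Finset ℕ) :=
  {B | B ⊆ Finset.Icc 1 m ∧ precLT B A}

/-- `F^m_{⪯ A}`: all subsets of `[m]` preceding (or equal to) `A`. -/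
def FprecLE (m : ℕ) (A : Finset ℕ) : Set (Finset ℕ) :=
  {B | B ⊆ Finset.Icc 1 m ∧ precLE B A}

/-- The `j`-th value (0-indexed) of an enumeration `i : Fin n → ℕ`. -/
def ith {n : ℕ} (i : Fin n → ℕ) (j : ℕ) : ℕ := if h : j < n then i ⟨j, h⟩ else 0

/-- The `ℓ`-th entry (1-indexed) of the enumeration, as an integer, with `i_0 = -1`. -/
def ivZ {n : ℕ} (i : Fin n → ℕ) (ℓ : ℕ) : ℤ := if ℓ = 0 then -1 else (ith i (ℓ - 1) : ℤ)

/-- For `B = i_1 i_2 ⋯ i_n` (increasing), with `d_1 = i_1` and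
`d_ℓ = i_ℓ - (i_{ℓ-1} + 1)`, `r_B = Σ_{k=2}^{n-2} C(k,2) + Σ_{ℓ=1}^{n-2} d_ℓ·C(n-ℓ,2)`. -/
def rA (B : Finset ℕ) : ℕ :=
  (∑ k ∈ Finset.Icc 2 (B.card - 2), Nat.choose k 2) +
    ∑ ℓ ∈ Finset.Icc 1 (B.card - 2),
      ((B.sort (· ≤ ·)).getD (ℓ - 1) 0 -
        (if ℓ = 1 then 0 else (B.sort (· ≤ ·)).getD (ℓ - 2) 0 + 1)) * Nat.choose (B.card - ℓ) 2

/-- For `B = i_1 i_2 ⋯ i_n` (increasing), with `c_1 = i_1 - 1` and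
`c_ℓ = i_ℓ - (i_{ℓ-1} + 1)`, `s_B = Σ_{k=2}^{n-2} C(k,2) + Σ_{ℓ=1}^{n-2} c_ℓ·C(n-ℓ,2)`. -/
def sA (B : Finset ℕ) : ℕ :=
  (∑ k ∈ Finset.Icc 2 (B.card - 2), Nat.choose k 2) +
    ∑ ℓ ∈ Finset.Icc 1 (B.card - 2),
      ((B.sort (· ≤ ·)).getD (ℓ - 1) 0 -
        (if ℓ = 1 then 1 else (B.sort (· ≤ ·)).getD (ℓ - 2) 0 + 1)) * Nat.choose (B.card - ℓ) 2

/-- `t_n = Σ_{A ⊆ [m], |A| = n} r_A`. -/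
def tN (m n : ℕ) : ℕ :=
  ∑ A ∈ (Finset.Icc 1 m).powerset.filter (fun A => A.card = n), rA A

/-- `o_{m,n} = Σ { s_A : A ∈ F^m_{n+2}, min A ≥ 2 }`. -/
def omn (m n : ℕ) : ℕ :=
  ∑ A ∈ (Finset.Icc 1 m).powerset.filter (fun A => A.card = n + 2 ∧ ∀ x ∈ A, 2 ≤ x), sA A

section TriangleSphere

/-- The smallest barycentric coordinate of a point of the triangle. -/
noncomputable def triMin (y : Fin 3 → ℝ) : ℝ := min (y 0) (min (y 1) (y 2))

/-- A map from the triangle to `ℝ³ \ {0}` whose normalization collapses exactly the boundary. -/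
noncomputable def triVec (y : Fin 3 → ℝ) : EuclideanSpace ℝ (Fin 3) :=
  !₂[1 - 6 * triMin y, triMin y * (y 0 - y 1), triMin y * (y 1 - y 2)]

lemma continuous_triMin : Continuous triMin := by
  unfold triMin; fun_prop

lemma continuous_triVec : Continuous triVec := by
  have := continuous_triMin
  refine (PiLp.continuous_toLp 2 _).comp (continuous_pi fun j => ?_)
  fin_cases j <;> simp <;> fun_prop

lemma triMin_le (y : Fin 3 → ℝ) (j : Fin 3) : triMin y ≤ y j := by
  unfold triMin; fin_cases j <;> simp

lemma triMin_eq (y : Fin 3 → ℝ) : ∃ j, triMin y = y j := by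
  unfold triMin
  rcases min_choice (y 0) (min (y 1) (y 2)) with h | h
  · exact ⟨0, h⟩
  · rcases min_choice (y 1) (y 2) with h' | h'
    · exact ⟨1, h.trans h'⟩
    · exact ⟨2, h.trans h'⟩

lemma stdSimplex_sum_three {y : Fin 3 → ℝ} (hy : y ∈ stdSimplex ℝ (Fin 3)) :
    y 0 + y 1 + y 2 = 1 := by
  have := hy.2; rwa [Fin.sum_univ_three] at this

lemma triMin_nonneg {y : Fin 3 → ℝ} (hy : y ∈ stdSimplex ℝ (Fin 3)) : 0 ≤ triMin y := by
  obtain ⟨j, hj⟩ := triMin_eq y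
  rw [hj]; exact hy.1 j

lemma triMin_le_third {y : Fin 3 → ℝ} (hy : y ∈ stdSimplex ℝ (Fin 3)) : 3 * triMin y ≤ 1 := by
  have h := stdSimplex_sum_three hy
  linarith [triMin_le y 0, triMin_le y 1, triMin_le y 2]

lemma triVec_ne_zero {y : Fin 3 → ℝ} (hy : y ∈ stdSimplex ℝ (Fin 3)) : triVec y ≠ 0 := by
  intro h
  have h0 : 1 - 6 * triMin y = 0 := by simpa [triVec] using congrArg (fun v => v 0) h
  have h1 : triMin y = 0 ∨ y 0 - y 1 = 0 := by
    simpa [triVec] using congrArg (fun v => v 1) h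
  have h2 : triMin y = 0 ∨ y 1 - y 2 = 0 := by
    simpa [triVec] using congrArg (fun v => v 2) h
  have hs := stdSimplex_sum_three hy
  obtain ⟨j, hj⟩ := triMin_eq y
  rcases h1 with h1 | h1
  · linarith
  rcases h2 with h2 | h2
  · linarith
  fin_cases j <;> simp at hj <;> linarith

lemma triVec_coord {y y' : Fin 3 → ℝ} {k : ℝ} (h : triVec y = k • triVec y') :
    1 - 6 * triMin y = k * (1 - 6 * triMin y') ∧
      triMin y * (y 0 - y 1) = k * (triMin y' * (y' 0 - y' 1)) ∧
      triMin y * (y 1 - y 2) = k * (triMin y' * (y' 1 - y' 2)) :=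
  ⟨by simpa [triVec] using congrArg (fun v => v 0) h,
    by simpa [triVec] using congrArg (fun v => v 1) h,
    by simpa [triVec] using congrArg (fun v => v 2) h⟩

lemma triMin_eq_zero_of_proportional {y y' : Fin 3 → ℝ} (hy : y ∈ stdSimplex ℝ (Fin 3)) {k : ℝ}
    (hk : 0 < k) (h : triVec y = k • triVec y') (h0 : triMin y' = 0) : triMin y = 0 := by
  obtain ⟨e0, e1, e2⟩ := triVec_coord h
  by_contra hne
  simp only [h0, zero_mul, mul_zero, mul_eq_zero, hne, false_or] at e1 e2 e0
  have hs := stdSimplex_sum_three hy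
  obtain ⟨j, hj⟩ := triMin_eq y
  have : triMin y = 1 / 3 := by fin_cases j <;> simp at hj <;> linarith
  linarith

lemma eq_of_triVec_proportional {y y' : Fin 3 → ℝ} (hy : y ∈ stdSimplex ℝ (Fin 3))
    (hy' : y' ∈ stdSimplex ℝ (Fin 3)) {k : ℝ} (hk : 0 < k) (h : triVec y = k • triVec y')
    (h0 : triMin y ≠ 0) (h0' : triMin y' ≠ 0) : y = y' := by
  obtain ⟨e0, e1, e2⟩ := triVec_coord h
  have hs := stdSimplex_sum_three hy
  have hs' := stdSimplex_sum_three hy'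
  have p := lt_of_le_of_ne (triMin_nonneg hy) (Ne.symm h0)
  have p' := lt_of_le_of_ne (triMin_nonneg hy') (Ne.symm h0')
  have q := triMin_le_third hy
  have q' := triMin_le_third hy'
  obtain ⟨κ, hκ, hκe⟩ : ∃ κ : ℝ, 0 < κ ∧ κ * triMin y = k * triMin y' :=
    ⟨k * triMin y' / triMin y, by positivity, by field_simp⟩
  have d1 : y 0 - y 1 = κ * (y' 0 - y' 1) := by
    apply mul_left_cancel₀ p.ne'
    linear_combination e1 - (y' 0 - y' 1) * hκe
  have d2 : y 1 - y 2 = κ * (y' 1 - y' 2) := by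
    apply mul_left_cancel₀ p.ne'
    linear_combination e2 - (y' 1 - y' 2) * hκe
  have c0 : y 0 - 1 / 3 = κ * (y' 0 - 1 / 3) := by
    linear_combination (2 * d1 + d2) / 3 + (hs - κ * hs') / 3
  have c1 : y 1 - 1 / 3 = κ * (y' 1 - 1 / 3) := by linear_combination c0 - d1
  have c2 : y 2 - 1 / 3 = κ * (y' 2 - 1 / 3) := by linear_combination c1 - d2
  have c : ∀ j, y j - 1 / 3 = κ * (y' j - 1 / 3) := by
    intro j; fin_cases j; exacts [c0, c1, c2]
  have hμ : triMin y - 1 / 3 = κ * (triMin y' - 1 / 3) := by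
    obtain ⟨j, hj⟩ := triMin_eq y
    obtain ⟨j', hj'⟩ := triMin_eq y'
    have a1 := triMin_le y j'
    have a2 := mul_le_mul_of_nonneg_left (triMin_le y' j) hκ.le
    have := c j
    have := c j'
    rw [hj'] at a2 ⊢
    rw [hj] at a1 ⊢
    linarith
  have key : (1 - 6 * triMin y) * (triMin y' * (1 / 3 - triMin y')) =
      (1 - 6 * triMin y') * (triMin y * (1 / 3 - triMin y)) := by
    rw [e0]
    linear_combination (-(1 - 6 * triMin y') * (1 / 3 - triMin y')) * hκe +
      (1 - 6 * triMin y') * triMin y * hμ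
  have key2 : (triMin y' - triMin y) *
      ((1 - 3 * triMin y) * (1 - 3 * triMin y') + 9 * triMin y * triMin y') = 0 := by
    linear_combination 3 * key
  have hpos : 0 < (1 - 3 * triMin y) * (1 - 3 * triMin y') + 9 * triMin y * triMin y' := by
    have := mul_nonneg (sub_nonneg.2 q) (sub_nonneg.2 q')
    have := mul_pos p p'
    linarith
  have hμe : triMin y' = triMin y := by
    rcases mul_eq_zero.1 key2 with h | h <;> linarith
  have hfin : ∀ j, y j = y' j := by
    rw [hμe] at hμ
    rcases mul_eq_zero.1 (show (1 - κ) * (triMin y - 1 / 3) = 0 by linarith) with h | h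
    · have : κ = 1 := by linarith
      intro j
      have := c j
      rw [‹κ = 1›] at this
      linarith
    · have l := fun j => triMin_le y j
      have l' := fun j => triMin_le y' j
      intro j
      have := l 0; have := l 1; have := l 2; have := l' 0; have := l' 1; have := l' 2
      fin_cases j <;> simp <;> linarith
  exact funext hfin

lemma triMin_sub_smul (r : ℝ) (hr : 0 ≤ r) (v : Fin 3 → ℝ) :
    triMin (fun j => 1 / 3 + r * v j) = 1 / 3 + r * triMin v := by
  unfold triMin
  rw [mul_min_of_nonneg _ _ hr, mul_min_of_nonneg _ _ hr, min_add_add_left, min_add_add_left]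

lemma exists_triVec_eq_smul (s : EuclideanSpace ℝ (Fin 3)) (hs : s 1 ≠ 0 ∨ s 2 ≠ 0) :
    ∃ y ∈ stdSimplex ℝ (Fin 3), ∃ k : ℝ, 0 ≤ k ∧ triVec y = k • s := by
  set v : Fin 3 → ℝ := ![(2 * s 1 + s 2) / 3, (s 2 - s 1) / 3, (-s 1 - 2 * s 2) / 3] with hv
  have v0 : v 0 = (2 * s 1 + s 2) / 3 := rfl
  have v1 : v 1 = (s 2 - s 1) / 3 := rfl
  have v2 : v 2 = (-s 1 - 2 * s 2) / 3 := rfl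
  have hneg : triMin v < 0 := by
    by_contra hcon
    have h0 := triMin_le v 0
    have h1 := triMin_le v 1
    have h2 := triMin_le v 2
    rcases hs with hs | hs <;> apply hs <;> linarith
  set R : ℝ := 1 / (3 * -triMin v) with hR
  have hR0 : 0 ≤ R := by
    have : 0 < -triMin v := by linarith
    positivity
  have hRv : R * triMin v = -(1 / 3) := by
    have := hneg.ne
    rw [hR]; field_simp
  obtain ⟨r, hr, hr0⟩ : ∃ r ∈ Set.Icc 0 R,
      1 - 6 * (1 / 3 + r * triMin v) - s 0 * ((1 / 3 + r * triMin v) * r) = 0 := by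
    have hc : ContinuousOn (fun r : ℝ => 1 - 6 * (1 / 3 + r * triMin v) -
        s 0 * ((1 / 3 + r * triMin v) * r)) (Set.Icc 0 R) := by fun_prop
    exact intermediate_value_Icc hR0 hc ⟨by norm_num, by norm_num [hRv]⟩
  have hμ0 : 0 ≤ 1 / 3 + r * triMin v := by
    nlinarith [mul_le_mul_of_nonpos_right hr.2 hneg.le]
  have hμ := triMin_sub_smul r hr.1 v
  refine ⟨fun j => 1 / 3 + r * v j, ⟨fun j => ?_, ?_⟩, (1 / 3 + r * triMin v) * r,
    mul_nonneg hμ0 hr.1, ?_⟩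
  · rw [← hμ] at hμ0
    exact hμ0.trans (triMin_le _ j)
  · rw [Fin.sum_univ_three, v0, v1, v2]; ring
  · rw [triVec, hμ]
    ext j
    fin_cases j
    · simp; linarith
    · simp [v0, v1]; ring
    · simp [v1, v2]; ring

/-- The quotient map from the triangle to the sphere collapsing the boundary to the base point. -/
noncomputable def triSph (y : stdSimplex ℝ (Fin 3)) : Sph 2 :=
  ⟨‖triVec y.1‖⁻¹ • triVec y.1, by
    have := norm_ne_zero_iff.2 (triVec_ne_zero y.2)
    simp [norm_smul, this]⟩

lemma continuous_triSph : Continuous triSph := by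
  refine Continuous.subtype_mk ?_ _
  have h : Continuous fun y : stdSimplex ℝ (Fin 3) => triVec y.1 :=
    continuous_triVec.comp continuous_subtype_val
  exact (h.norm.inv₀ fun y => norm_ne_zero_iff.2 (triVec_ne_zero y.2)).smul h

lemma triSph_eq_of_smul {y : stdSimplex ℝ (Fin 3)} {s : Sph 2} {k : ℝ} (hk : 0 ≤ k)
    (h : triVec y.1 = k • (s : EuclideanSpace ℝ (Fin 3))) : triSph y = s := by
  have hs : ‖(s : EuclideanSpace ℝ (Fin 3))‖ = 1 := by simp
  have hn : ‖triVec y.1‖ = k := by rw [h, norm_smul, hs, mul_one, Real.norm_of_nonneg hk]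
  have hk0 : k ≠ 0 := by rw [← hn]; exact norm_ne_zero_iff.2 (triVec_ne_zero y.2)
  apply Subtype.ext
  change ‖triVec y.1‖⁻¹ • triVec y.1 = _
  rw [hn, h, smul_smul, inv_mul_cancel₀ hk0, one_smul]

lemma triSph_eq_base {y : stdSimplex ℝ (Fin 3)} (h : triMin y.1 = 0) : triSph y = sphBase 2 := by
  refine triSph_eq_of_smul zero_le_one ?_
  ext j
  fin_cases j <;> simp [triVec, h, sphBase]

lemma triSph_fibres {y y' : stdSimplex ℝ (Fin 3)} (h : triSph y = triSph y') :
    y = y' ∨ (triMin y.1 = 0 ∧ triMin y'.1 = 0) := by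
  have prop : ∀ {y y' : stdSimplex ℝ (Fin 3)}, triSph y = triSph y' →
      ∃ k : ℝ, 0 < k ∧ triVec y.1 = k • triVec y'.1 := by
    intro y y' h
    have h1 : ‖triVec y.1‖⁻¹ • triVec y.1 = ‖triVec y'.1‖⁻¹ • triVec y'.1 :=
      congrArg Subtype.val h
    have p := norm_pos_iff.2 (triVec_ne_zero y.2)
    have p' := norm_pos_iff.2 (triVec_ne_zero y'.2)
    refine ⟨‖triVec y.1‖ * ‖triVec y'.1‖⁻¹, by positivity, ?_⟩
    rw [mul_smul, ← h1, smul_smul, mul_inv_cancel₀ p.ne', one_smul]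
  obtain ⟨k, hk, hkv⟩ := prop h
  obtain ⟨k', hk', hkv'⟩ := prop h.symm
  by_cases h0 : triMin y.1 = 0
  · exact Or.inr ⟨h0, triMin_eq_zero_of_proportional y'.2 hk' hkv' h0⟩
  by_cases h0' : triMin y'.1 = 0
  · exact Or.inr ⟨triMin_eq_zero_of_proportional y.2 hk hkv h0', h0'⟩
  exact Or.inl (Subtype.ext (eq_of_triVec_proportional y.2 y'.2 hk hkv h0 h0'))

lemma surjective_triSph : Function.Surjective triSph := by
  intro s
  have hs : ‖(s : EuclideanSpace ℝ (Fin 3))‖ = 1 := by simp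
  by_cases h : s.1 1 ≠ 0 ∨ s.1 2 ≠ 0
  · obtain ⟨y, hy, k, hk, e⟩ := exists_triVec_eq_smul s.1 h
    exact ⟨⟨y, hy⟩, triSph_eq_of_smul hk e⟩
  · push Not at h
    have h0 : s.1 0 = 1 ∨ s.1 0 = -1 := by
      rw [EuclideanSpace.norm_eq, Fin.sum_univ_three, h.1, h.2] at hs
      simpa [Real.sqrt_sq_eq_abs, abs_eq] using hs
    rcases h0 with h0 | h0
    · refine ⟨⟨![1, 0, 0], fun j => by fin_cases j <;> simp, by simp [Fin.sum_univ_three]⟩, ?_⟩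
      refine triSph_eq_of_smul zero_le_one ?_
      ext j
      fin_cases j <;> simp [triVec, triMin, h0, h.1, h.2]
    · refine ⟨⟨fun _ => 1 / 3, fun j => by simp, by simp⟩, ?_⟩
      refine triSph_eq_of_smul zero_le_one ?_
      ext j
      fin_cases j <;> simp [triVec, triMin, h0, h.1, h.2]
      norm_num

lemma isQuotientMap_triSph : Topology.IsQuotientMap triSph :=
  continuous_triSph.isClosedMap.isQuotientMap continuous_triSph surjective_triSph

end TriangleSphere

section WedgeMaps

variable {c : ℕ} {X : Type} [TopologicalSpace X] {x₀ : X}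

/-- The inclusion of the `i`-th summand of a wedge. -/
def wedgeIncl (x₀ : X) (i : Fin c) : C(X, Wedge c X x₀) where
  toFun x := Quot.mk _ (Sum.inr (i, x))
  continuous_toFun := continuous_quot_mk.comp (continuous_inr.comp (by fun_prop))

lemma wedgeIncl_base (i : Fin c) : wedgeIncl x₀ i x₀ = wedgePt c X x₀ :=
  (Quot.sound (wedgeRel.glue i)).symm

lemma Wedge.cases {P : Wedge c X x₀ → Prop} (base : P (wedgePt c X x₀))
    (incl : ∀ i x, P (wedgeIncl x₀ i x)) (w : Wedge c X x₀) : P w := by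
  induction w using Quot.ind with
  | mk a =>
    rcases a with a | ⟨i, x⟩
    exacts [base, incl i x]

/-- The map out of a wedge determined by pointed maps out of its summands. -/
def wedgeLift {Z : Type*} [TopologicalSpace Z] (z : Z) (g : Fin c → C(X, Z))
    (hg : ∀ i, g i x₀ = z) : C(Wedge c X x₀, Z) where
  toFun := Quot.lift (Sum.elim (fun _ => z) fun p => g p.1 p.2) (by
    rintro _ _ ⟨i⟩
    exact (hg i).symm)
  continuous_toFun := by
    refine continuous_quot_lift _ (continuous_const.sumElim ?_)
    exact continuous_prod_of_discrete_left.2 fun i => (g i).continuous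

/-- A space made of a subspace `S` and of triangles attached to `S` along their boundaries, such
that `S` can be contracted by a homotopy of the whole space, is a wedge of spheres. -/
theorem homotopyEquiv_wedge_of_collapse {Y : Type} [TopologicalSpace Y] (S : Set Y) (p : Y) (hp : p ∈ S)
    (τ : Fin c → C(stdSimplex ℝ (Fin 3), Y)) (f : C(Y, WedgeSph 2 c))
    (hcov : ∀ x, x ∈ S ∨ ∃ i y, x = τ i y)
    (hτ : ∀ i y, triMin y.1 = 0 → τ i y ∈ S)
    (hfS : ∀ x ∈ S, f x = wedgeSphPt 2 c)
    (hfτ : ∀ i y, f (τ i y) = wedgeIncl (sphBase 2) i (triSph y))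
    (φ : C(Y, Y)) (hφ : ∀ x ∈ S, φ x = p)
    (Φ : ContinuousMap.HomotopyWith (.id Y) φ fun g => ∀ x ∈ S, g x ∈ S) :
    Nonempty (ContinuousMap.HomotopyEquiv Y (WedgeSph 2 c)) := by
  have hq := isQuotientMap_triSph
  have hbase : ∀ {y}, triSph y = sphBase 2 → triMin y.1 = 0 := by
    intro y hy
    have h0 : triMin (![1, 0, 0] : Fin 3 → ℝ) = 0 := by simp [triMin]
    let y₀ : stdSimplex ℝ (Fin 3) :=
      ⟨![1, 0, 0], fun j => by fin_cases j <;> simp, by simp [Fin.sum_univ_three]⟩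
    rcases triSph_fibres (hy.trans (triSph_eq_base (y := y₀) h0).symm) with h | h
    exacts [h ▸ h0, h.1]
  have desc : ∀ {Z : Type} [TopologicalSpace Z] (z : Z) (k : Fin c → C(stdSimplex ℝ (Fin 3), Z)),
      (∀ i y, triMin y.1 = 0 → k i y = z) → ∃ g : C(WedgeSph 2 c, Z),
        g (wedgeSphPt 2 c) = z ∧ ∀ i y, g (wedgeIncl (sphBase 2) i (triSph y)) = k i y := by
    intro Z _ z k hk
    have hk' : ∀ i, ∀ y y', triSph y = triSph y' → k i y = k i y' := by
      intro i y y' h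
      rcases triSph_fibres h with h | h
      exacts [by rw [h], by rw [hk i y h.1, hk i y' h.2]]
    let g : Fin c → C(Sph 2, Z) := fun i =>
      Topology.IsQuotientMap.lift (f := ⟨triSph, continuous_triSph⟩) hq (k i)
        (fun y y' h => hk' i y y' h)
    have hg : ∀ i y, g i (triSph y) = k i y := fun i y =>
      DFunLike.congr_fun (Topology.IsQuotientMap.lift_comp
        (f := ⟨triSph, continuous_triSph⟩) hq (k i) (fun y y' h => hk' i y y' h)) y
    refine ⟨wedgeLift z g fun i => ?_, rfl, hg⟩
    obtain ⟨y, hy⟩ := surjective_triSph (sphBase 2)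
    rw [← hy, hg, hk i y (hbase hy)]
  obtain ⟨g, hg0, hg⟩ := desc p (fun i => φ.comp (τ i)) (fun i y h => hφ _ (hτ i y h))
  let Ψ : C(Y, C(unitInterval, WedgeSph 2 c)) :=
    ContinuousMap.curry ⟨fun q : Y × unitInterval => f (Φ (q.2, q.1)), by fun_prop⟩
  have hΨ : ∀ x t, Ψ x t = f (Φ (t, x)) := fun _ _ => rfl
  obtain ⟨G, hG0, hG⟩ := desc (.const _ (wedgeSphPt 2 c)) (fun i => Ψ.comp (τ i)) (by
    intro i y h
    ext t
    exact hfS _ (Φ.prop t _ (hτ i y h)))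
  refine ⟨⟨f, g, ?_, ?_⟩⟩
  · have : g.comp f = φ := by
      ext x
      rcases hcov x with h | ⟨i, y, rfl⟩
      · simp [hfS x h, hg0, hφ x h]
      · simp [hfτ, hg]
    rw [this]
    exact ⟨Φ.toHomotopy.symm⟩
  · refine ContinuousMap.Homotopic.symm ⟨⟨⟨fun q => G q.2 q.1, ?_⟩, ?_, ?_⟩⟩
    · exact (G.continuous.comp continuous_snd).eval continuous_fst
    · refine Wedge.cases ?_ fun i s => ?_
      · exact congrArg (fun h : C(unitInterval, WedgeSph 2 c) => h 0) hG0
      · obtain ⟨y, rfl⟩ := surjective_triSph s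
        simp [hG, hΨ, hfτ]
    · refine Wedge.cases ?_ fun i s => ?_
      · change G (wedgeSphPt 2 c) 1 = f (g (wedgeSphPt 2 c))
        rw [hG0, hg0, hfS p hp]
        rfl
      · obtain ⟨y, rfl⟩ := surjective_triSph s
        simp [hG, hΨ, hg]

end WedgeMaps

namespace AbsSC

section Realization

variable {V : Type} {K : AbsSC V} {X : Type*} [TopologicalSpace X]

lemma continuous_coord (v : V) : Continuous fun x : K.space => x.1 v :=
  (continuous_apply v).comp continuous_subtype_val

lemma continuous_of_coord {f : X → K.space} (h : ∀ v, Continuous fun x => (f x).1 v) :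
    Continuous f :=
  Continuous.subtype_mk (continuous_pi h) _

/-- The point `x` lies in the closed face `s`. -/
def Carries (s : Finset V) (x : K.space) : Prop := ∀ v, x.1 v ≠ 0 → v ∈ s

lemma exists_carries (x : K.space) : ∃ s ∈ K.faces, Carries s x := by
  obtain ⟨s, hs, h, -⟩ := x.2.2
  exact ⟨s, hs, h⟩

lemma isClosed_carries (s : Finset V) : IsClosed {x : K.space | Carries s x} := by
  have : {x : K.space | Carries s x} = ⋂ v, ⋂ (_ : v ∉ s), {x | x.1 v = 0} := by
    ext x
    simp only [Set.mem_iInter]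
    exact forall_congr' fun v => not_imp_comm
  rw [this]
  exact isClosed_iInter fun v => isClosed_iInter fun _ =>
    isClosed_eq (continuous_coord v) continuous_const

variable [Fintype V]

lemma sum_of_carries {s : Finset V} {x : K.space} (h : Carries s x) : ∑ v ∈ s, x.1 v = 1 := by
  obtain ⟨t, ht, h', hsum⟩ := x.2.2
  refine Eq.trans ?_ hsum
  rw [Finset.sum_subset (Finset.subset_univ s), Finset.sum_subset (Finset.subset_univ t)]
  · exact fun v _ hv => by_contra fun h0 => hv (h' v h0)
  · exact fun v _ hv => by_contra fun h0 => hv (h v h0)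

lemma sum_coord (x : K.space) : ∑ v, x.1 v = 1 :=
  sum_of_carries fun v _ => Finset.mem_univ v

/-- A point of the realization given by its coordinates. -/
def mkPoint (K : AbsSC V) (f : V → ℝ) (h0 : ∀ v, 0 ≤ f v) (h1 : ∑ v, f v = 1)
    (hs : ∃ s ∈ K.faces, ∀ v, f v ≠ 0 → v ∈ s) : K.space :=
  ⟨f, h0, by
    obtain ⟨s, hs, h⟩ := hs
    refine ⟨s, hs, h, ?_⟩
    rw [← h1]
    exact Finset.sum_subset (Finset.subset_univ s)
      fun v _ hv => by_contra fun h0 => hv (h v h0)⟩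

/-- The straight-line homotopy between two maps sending each point into a common face. -/
def lineHomotopy (f g : C(X, K.space))
    (h : ∀ x, ∃ s ∈ K.faces, Carries s (f x) ∧ Carries s (g x)) : f.Homotopy g where
  toFun q := K.mkPoint (fun v => (1 - q.1.1) * (f q.2).1 v + q.1.1 * (g q.2).1 v)
    (fun v => add_nonneg (mul_nonneg (sub_nonneg.2 q.1.2.2) ((f q.2).2.1 v))
      (mul_nonneg q.1.2.1 ((g q.2).2.1 v)))
    (by rw [Finset.sum_add_distrib, ← Finset.mul_sum, ← Finset.mul_sum, sum_coord, sum_coord]; ring)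
    (by
      obtain ⟨s, hs, hf, hg⟩ := h q.2
      refine ⟨s, hs, fun v hv => ?_⟩
      by_contra hvs
      have h1 := not_imp_comm.1 (hf v) hvs
      have h2 := not_imp_comm.1 (hg v) hvs
      simp [h1, h2] at hv)
  continuous_toFun := by
    refine continuous_of_coord fun v => ?_
    have hf : Continuous fun q : unitInterval × X => (f q.2).1 v :=
      (continuous_coord v).comp (f.continuous.comp continuous_snd)
    have hg : Continuous fun q : unitInterval × X => (g q.2).1 v :=
      (continuous_coord v).comp (g.continuous.comp continuous_snd)
    have ht : Continuous fun q : unitInterval × X => q.1.1 :=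
      continuous_subtype_val.comp continuous_fst
    exact ((continuous_const.sub ht).mul hf).add (ht.mul hg)
  map_zero_left x := Subtype.ext (funext fun v => by simp [mkPoint])
  map_one_left x := Subtype.ext (funext fun v => by simp [mkPoint])

lemma lineHomotopy_apply (f g : C(X, K.space))
    (h : ∀ x, ∃ s ∈ K.faces, Carries s (f x) ∧ Carries s (g x)) (t : unitInterval) (x : X) (v : V) :
    (lineHomotopy f g h (t, x)).1 v = (1 - t.1) * (f x).1 v + t.1 * (g x).1 v := rfl

lemma carries_lineHomotopy {f g : C(X, K.space)}
    (h : ∀ x, ∃ s ∈ K.faces, Carries s (f x) ∧ Carries s (g x)) {x : X} {s : Finset V}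
    (hf : Carries s (f x)) (hg : Carries s (g x)) (t : unitInterval) :
    Carries s (lineHomotopy f g h (t, x)) := by
  intro v hv
  by_contra hvs
  refine hv ((lineHomotopy_apply f g h t x v).trans ?_)
  rw [not_imp_comm.1 (hf v) hvs, not_imp_comm.1 (hg v) hvs, mul_zero, mul_zero, add_zero]

end Realization

/-- `K` is obtained from `L` by attaching the distinct triangles `T i`. -/
structure AttachTriangles {V : Type} [DecidableEq V] (K L : AbsSC V) {c : ℕ}
    (T : Fin c → Fin 3 → V) : Prop where
  injective : ∀ i, Function.Injective (T i)
  faces_iff : ∀ s, s ∈ K.faces ↔ s ∈ L.faces ∨ ∃ i, s = univ.image (T i)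
  not_mem : ∀ i, univ.image (T i) ∉ L.faces
  image_injective : Function.Injective fun i => univ.image (T i)

namespace AttachTriangles

variable {V : Type} {K L : AbsSC V} {c : ℕ} {T : Fin c → Fin 3 → V}

/-- The smallest coordinate of `x` at a vertex of the triangle `t`. -/
noncomputable def depth (t : Fin 3 → V) (x : K.space) : ℝ := triMin fun j => x.1 (t j)

lemma continuous_depth (t : Fin 3 → V) : Continuous (depth t : K.space → ℝ) :=
  continuous_triMin.comp (continuous_pi fun j => continuous_coord (t j))

lemma depth_nonneg (t : Fin 3 → V) (x : K.space) : 0 ≤ depth t x := by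
  obtain ⟨j, hj⟩ := triMin_eq fun j => x.1 (t j)
  rw [depth, hj]; exact x.2.1 _

lemma depth_le (t : Fin 3 → V) (x : K.space) (j : Fin 3) : depth t x ≤ x.1 (t j) :=
  triMin_le (fun j => x.1 (t j)) j

/-- The points of `K` which belong to the subcomplex `L`. -/
def subSpace (K L : AbsSC V) : Set K.space := {x | ∃ s ∈ L.faces, Carries s x}

lemma eq_of_carries {s : Finset V} {x x' : K.space} (h : Carries s x) (h' : Carries s x')
    (e : ∀ v ∈ s, x.1 v = x'.1 v) : x = x' := by
  refine Subtype.ext (funext fun v => ?_)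
  by_cases hv : v ∈ s
  · exact e v hv
  · rw [not_imp_comm.1 (h v) hv, not_imp_comm.1 (h' v) hv]

variable [DecidableEq V]

lemma image_subset_of_carries {t : Fin 3 → V} {x : K.space} (h : 0 < depth t x) {s : Finset V}
    (hs : Carries s x) : univ.image t ⊆ s := by
  intro v hv
  obtain ⟨j, -, rfl⟩ := Finset.mem_image.1 hv
  exact hs _ (h.trans_le (depth_le t x j)).ne'

lemma image_nonempty (t : Fin 3 → V) : univ.image t ≠ ∅ :=
  (Finset.univ_nonempty.image t).ne_empty

variable (hT : AttachTriangles K L T)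
include hT

lemma card_image (i : Fin c) : (univ.image (T i)).card = 3 := by
  rw [Finset.card_image_of_injective _ (hT.injective i)]; rfl

lemma eq_of_image_subset {i j : Fin c} (h : univ.image (T i) ⊆ univ.image (T j)) : i = j :=
  hT.image_injective (Finset.eq_of_subset_of_card_le h (by rw [hT.card_image, hT.card_image]))

lemma carries_image {i : Fin c} {x : K.space} (h : 0 < depth (T i) x) :
    Carries (univ.image (T i)) x := by
  obtain ⟨s, hs, hx⟩ := exists_carries x
  have hsub := image_subset_of_carries h hx
  rcases (hT.faces_iff s).1 hs with hL | ⟨j, rfl⟩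
  · exact (hT.not_mem i (L.down_closed _ hL _ hsub (image_nonempty _))).elim
  · rwa [hT.eq_of_image_subset hsub]

lemma depth_eq_zero_of_ne {i j : Fin c} {x : K.space} (h : 0 < depth (T i) x) (hij : j ≠ i) :
    depth (T j) x = 0 := by
  by_contra h0
  have hj := lt_of_le_of_ne (depth_nonneg (T j) x) (Ne.symm h0)
  exact hij (hT.eq_of_image_subset (image_subset_of_carries hj (hT.carries_image h)))

variable [Fintype V]

lemma coord_mem_stdSimplex {i : Fin c} {x : K.space} (h : Carries (univ.image (T i)) x) :
    (fun j => x.1 (T i j)) ∈ stdSimplex ℝ (Fin 3) := by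
  refine ⟨fun j => x.2.1 _, ?_⟩
  have hsum := sum_of_carries h
  rwa [Finset.sum_image fun a _ b _ hab => hT.injective i hab] at hsum

lemma mem_subSpace_iff {x : K.space} : x ∈ subSpace K L ↔ ∀ i, depth (T i) x = 0 := by
  constructor
  · rintro ⟨s, hs, hx⟩ i
    by_contra h0
    have hi := lt_of_le_of_ne (depth_nonneg (T i) x) (Ne.symm h0)
    exact hT.not_mem i (L.down_closed _ hs _ (image_subset_of_carries hi hx) (image_nonempty _))
  · intro h
    obtain ⟨s, hs, hx⟩ := exists_carries x
    set s' := univ.filter fun v => x.1 v ≠ 0 with hs'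
    have hx' : Carries s' x := fun v hv => by simp [hs', hv]
    have hne : s' ≠ ∅ := by
      intro he
      have := sum_of_carries hx'
      rw [he] at this
      simp at this
    have hK : s' ∈ K.faces := K.down_closed _ hs _ (fun v hv => hx v (by simpa [hs'] using hv)) hne
    rcases (hT.faces_iff s').1 hK with hL | ⟨i, hi⟩
    · exact ⟨s', hL, hx'⟩
    · obtain ⟨j, hj⟩ := triMin_eq fun j => x.1 (T i j)
      have hm : T i j ∈ s' := by rw [hi]; simp
      rw [← depth, h i] at hj
      simp [hs', ← hj] at hm

lemma mem_subSpace_or (x : K.space) : x ∈ subSpace K L ∨ ∃ i, 0 < depth (T i) x := by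
  by_cases h : x ∈ subSpace K L
  · exact Or.inl h
  · rw [hT.mem_subSpace_iff] at h
    push Not at h
    obtain ⟨i, hi⟩ := h
    exact Or.inr ⟨i, lt_of_le_of_ne (depth_nonneg _ _) (Ne.symm hi)⟩

lemma isClosed_subSpace : IsClosed (subSpace K L) := by
  have : subSpace K L = ⋂ i, {x | depth (T i) x = 0} := by
    ext x
    rw [hT.mem_subSpace_iff, Set.mem_iInter]
    rfl
  rw [this]
  exact isClosed_iInter fun i => isClosed_eq (continuous_depth _) continuous_const

/-- The parametrization of an attached triangle. -/
noncomputable def param (i : Fin c) : C(stdSimplex ℝ (Fin 3), K.space) where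
  toFun y := K.mkPoint (fun v => ∑ j, if T i j = v then y.1 j else 0)
    (fun v => Finset.sum_nonneg fun j _ => by
      split_ifs
      exacts [y.2.1 j, le_rfl])
    (by
      rw [Finset.sum_comm]
      simpa using y.2.2)
    ⟨univ.image (T i), (hT.faces_iff _).2 (Or.inr ⟨i, rfl⟩), fun v hv => by
      obtain ⟨j, -, hj⟩ := Finset.exists_ne_zero_of_sum_ne_zero hv
      have : T i j = v := by_contra fun h => hj (by simp [h])
      simp [← this]⟩
  continuous_toFun := by
    refine continuous_of_coord fun v => ?_
    change Continuous fun y : stdSimplex ℝ (Fin 3) => ∑ j, if T i j = v then y.1 j else 0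
    refine continuous_finsetSum _ fun j _ => ?_
    by_cases h : T i j = v
    · simp only [h, if_true]
      exact (continuous_apply j).comp continuous_subtype_val
    · simpa only [h, if_false] using continuous_const

lemma param_coord (i : Fin c) (y : stdSimplex ℝ (Fin 3)) (j : Fin 3) :
    (hT.param i y).1 (T i j) = y.1 j := by
  change (∑ k, if T i k = T i j then y.1 k else 0) = y.1 j
  simp [(hT.injective i).eq_iff]

lemma depth_param (i : Fin c) (y : stdSimplex ℝ (Fin 3)) :
    depth (T i) (hT.param i y) = triMin y.1 := by
  unfold depth
  congr 1
  exact funext fun j => hT.param_coord i y j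

lemma carries_param (i : Fin c) (y : stdSimplex ℝ (Fin 3)) :
    Carries (univ.image (T i)) (hT.param i y) := by
  intro v hv
  change (∑ j, if T i j = v then y.1 j else 0) ≠ 0 at hv
  obtain ⟨j, -, hj⟩ := Finset.exists_ne_zero_of_sum_ne_zero hv
  have : T i j = v := by_contra fun h => hj (by simp [h])
  simp [← this]

lemma eq_param {i : Fin c} {x : K.space} (h : Carries (univ.image (T i)) x) :
    x = hT.param i ⟨_, hT.coord_mem_stdSimplex h⟩ := by
  refine eq_of_carries h (hT.carries_param i _) fun v hv => ?_
  obtain ⟨j, -, rfl⟩ := Finset.mem_image.1 hv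
  rw [hT.param_coord]

lemma param_mem_subSpace {i : Fin c} {y : stdSimplex ℝ (Fin 3)} (h : triMin y.1 = 0) :
    hT.param i y ∈ subSpace K L := by
  rcases hT.mem_subSpace_or (hT.param i y) with h' | ⟨j, hj⟩
  · exact h'
  · have : i = j := by
      have hs := image_subset_of_carries hj (hT.carries_param i y)
      exact (hT.eq_of_image_subset hs).symm
    subst this
    rw [hT.depth_param, h] at hj
    exact (lt_irrefl _ hj).elim

end AttachTriangles

end AbsSC

namespace AbsSC.AttachTriangles

variable {V : Type} {K L : AbsSC V} {c : ℕ} {T : Fin c → Fin 3 → V} [DecidableEq V]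

/-- The expansion factor (minus one) used on the triangle `t`. -/
noncomputable def factor (t : Fin 3 → V) (x : K.space) : ℝ := (max (1 / 2) (1 - 3 * depth t x))⁻¹ - 1

omit [DecidableEq V] in
lemma continuous_factor (t : Fin 3 → V) : Continuous (factor t : K.space → ℝ) := by
  refine Continuous.sub (Continuous.inv₀ ?_ fun x => ?_) continuous_const
  · exact continuous_const.max (continuous_const.sub (continuous_const.mul (continuous_depth t)))
  · exact (lt_of_lt_of_le (by norm_num) (le_max_left _ _)).ne'

omit [DecidableEq V] in
lemma factor_eq_zero {t : Fin 3 → V} {x : K.space} (h : depth t x = 0) : factor t x = 0 := by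
  norm_num [factor, h]

/-- The coordinates of the radial expansion of the attached triangles from their barycentres. -/
noncomputable def expandFun (T : Fin c → Fin 3 → V) (x : K.space) (v : V) : ℝ :=
  x.1 v + ∑ i, factor (T i) x * (x.1 v - if v ∈ univ.image (T i) then 1 / 3 else 0)

variable (hT : AttachTriangles K L T)
include hT

lemma expandFun_of_pos {i : Fin c} {x : K.space} (h : 0 < depth (T i) x) (v : V) :
    expandFun T x v =
      x.1 v + factor (T i) x * (x.1 v - if v ∈ univ.image (T i) then 1 / 3 else 0) := by
  rw [expandFun, Finset.sum_eq_single i (fun j _ hj => by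
    rw [factor_eq_zero (hT.depth_eq_zero_of_ne h hj), zero_mul]) (by simp)]

variable [Fintype V]

lemma expandFun_of_mem {x : K.space} (h : x ∈ subSpace K L) (v : V) : expandFun T x v = x.1 v := by
  rw [hT.mem_subSpace_iff] at h
  simp [expandFun, factor_eq_zero (h _)]

lemma expandFun_nonneg (x : K.space) (v : V) : 0 ≤ expandFun T x v := by
  rcases hT.mem_subSpace_or x with h | ⟨i, h⟩
  · rw [hT.expandFun_of_mem h]; exact x.2.1 v
  · rw [hT.expandFun_of_pos h]
    by_cases hv : v ∈ univ.image (T i)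
    · obtain ⟨j, -, rfl⟩ := Finset.mem_image.1 hv
      have h1 := depth_le (T i) x j
      rw [if_pos hv, factor]
      set M := max (1 / 2) (1 - 3 * depth (T i) x) with hM
      have h2 : 1 - 3 * depth (T i) x ≤ M := le_max_right _ _
      have h3 : (0 : ℝ) < M := lt_of_lt_of_le (by norm_num) (le_max_left _ _)
      have e : x.1 (T i j) + (M⁻¹ - 1) * (x.1 (T i j) - 1 / 3) =
          M⁻¹ * (x.1 (T i j) - (1 - M) / 3) := by field_simp; ring
      rw [e]
      exact mul_nonneg (inv_nonneg.2 h3.le) (by linarith)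
    · have := not_imp_comm.1 (hT.carries_image h v) hv
      rw [if_neg hv, this]; simp

lemma expandFun_eq_zero {x : K.space} {v : V} (h : x.1 v = 0) : expandFun T x v = 0 := by
  rcases hT.mem_subSpace_or x with h' | ⟨i, h'⟩
  · rw [hT.expandFun_of_mem h', h]
  · rw [hT.expandFun_of_pos h', h, if_neg, sub_zero, mul_zero, add_zero]
    intro hv
    obtain ⟨j, -, rfl⟩ := Finset.mem_image.1 hv
    linarith [depth_le (T i) x j]

lemma sum_expandFun (x : K.space) : ∑ v, expandFun T x v = 1 := by
  simp only [expandFun]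
  rw [Finset.sum_add_distrib, sum_coord, Finset.sum_comm]
  refine add_eq_left.2 (Finset.sum_eq_zero fun i _ => ?_)
  rw [← Finset.mul_sum, Finset.sum_sub_distrib, sum_coord, Finset.sum_ite_mem, Finset.univ_inter,
    Finset.sum_const, hT.card_image]
  norm_num

/-- The radial expansion of the attached triangles, which pushes a neighbourhood of `L` into `L`. -/
noncomputable def expand : C(K.space, K.space) where
  toFun x := K.mkPoint (expandFun T x) (hT.expandFun_nonneg x) (hT.sum_expandFun x) (by
    obtain ⟨s, hs, hx⟩ := exists_carries x
    exact ⟨s, hs, fun v hv => hx v fun h => hv (hT.expandFun_eq_zero h)⟩)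
  continuous_toFun := by
    refine continuous_of_coord fun v => ?_
    change Continuous fun x : K.space => expandFun T x v
    refine (continuous_coord v).add (continuous_finsetSum _ fun i _ => ?_)
    exact (continuous_factor _).mul ((continuous_coord v).sub continuous_const)

lemma carries_expand {s : Finset V} {x : K.space} (h : Carries s x) : Carries s (hT.expand x) :=
  fun v hv => h v fun h0 => hv (hT.expandFun_eq_zero h0)

lemma expand_of_mem {x : K.space} (h : x ∈ subSpace K L) : hT.expand x = x :=
  Subtype.ext (funext (hT.expandFun_of_mem h))

lemma expand_mem {x : K.space} (h : ∀ i, depth (T i) x ≤ 1 / 6) :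
    hT.expand x ∈ subSpace K L := by
  rcases hT.mem_subSpace_or x with h' | ⟨i, h'⟩
  · rwa [hT.expand_of_mem h']
  rcases hT.mem_subSpace_or (hT.expand x) with h2 | ⟨k, hk⟩
  · exact h2
  have hki : k = i :=
    hT.eq_of_image_subset (image_subset_of_carries hk (hT.carries_expand (hT.carries_image h')))
  subst hki
  obtain ⟨j, hj⟩ := triMin_eq fun j => x.1 (T k j)
  rw [← depth] at hj
  have h4 := depth_le (T k) (hT.expand x) j
  change _ ≤ expandFun T x (T k j) at h4
  rw [hT.expandFun_of_pos h', if_pos (by simp), ← hj, factor,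
    max_eq_right (by linarith [h k])] at h4
  have h5 : 1 - 3 * depth (T k) x ≠ 0 := (by linarith [h k] : (0 : ℝ) < _).ne'
  have e : depth (T k) x + ((1 - 3 * depth (T k) x)⁻¹ - 1) * (depth (T k) x - 1 / 3) = 0 := by
    have := inv_mul_cancel₀ h5
    linear_combination (-1 / 3) * this
  linarith

/-- The map collapsing `L` to the base point and each attached triangle onto a sphere. -/
noncomputable def collapseFun (x : K.space) : WedgeSph 2 c := by
  classical
  exact if h : ∃ i, 0 < depth (T i) x then
    wedgeIncl (sphBase 2) h.choose
      (triSph ⟨_, hT.coord_mem_stdSimplex (hT.carries_image h.choose_spec)⟩)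
  else wedgeSphPt 2 c

lemma collapseFun_of_mem {x : K.space} (h : x ∈ subSpace K L) :
    hT.collapseFun x = wedgeSphPt 2 c := by
  rw [hT.mem_subSpace_iff] at h
  exact dif_neg fun ⟨i, hi⟩ => hi.ne' (h i)

lemma collapseFun_of_carries {i : Fin c} {x : K.space} (h : Carries (univ.image (T i)) x) :
    hT.collapseFun x = wedgeIncl (sphBase 2) i (triSph ⟨_, hT.coord_mem_stdSimplex h⟩) := by
  by_cases h' : ∃ k, 0 < depth (T k) x
  · have hc : h'.choose = i :=
      hT.eq_of_image_subset (image_subset_of_carries h'.choose_spec h)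
    refine (dif_pos h').trans ?_
    congr!
  · refine (dif_neg h').trans ?_
    rw [triSph_eq_base, wedgeIncl_base]
    · rfl
    · exact le_antisymm (not_lt.1 fun h0 => h' ⟨i, h0⟩) (depth_nonneg (T i) x)

lemma continuous_collapseFun : Continuous hT.collapseFun := by
  let S : Option (Fin c) → Set K.space :=
    fun o => o.elim (subSpace K L) fun i => {x | Carries (univ.image (T i)) x}
  refine (locallyFinite_of_finite S).continuous ?_ ?_ ?_
  · refine Set.eq_univ_of_forall fun x => Set.mem_iUnion.2 ?_
    rcases hT.mem_subSpace_or x with h | ⟨i, h⟩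
    exacts [⟨none, h⟩, ⟨some i, hT.carries_image h⟩]
  · rintro (_ | i)
    exacts [hT.isClosed_subSpace, isClosed_carries _]
  · rintro (_ | i)
    · exact continuousOn_const.congr fun x hx => hT.collapseFun_of_mem hx
    · rw [continuousOn_iff_continuous_domRestrict]
      have : (S (some i)).domRestrict hT.collapseFun = fun x => wedgeIncl (sphBase 2) i
          (triSph ⟨_, hT.coord_mem_stdSimplex x.2⟩) :=
        funext fun x => hT.collapseFun_of_carries x.2
      rw [this]
      refine (wedgeIncl (sphBase 2) i).continuous.comp (continuous_triSph.comp ?_)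
      refine Continuous.subtype_mk (continuous_pi fun j => ?_) _
      exact (continuous_coord _).comp continuous_subtype_val

end AbsSC.AttachTriangles

namespace AbsSC.AttachTriangles

variable {V : Type} [Fintype V] {K L : AbsSC V}

/-- A point of `K` in the subcomplex `L`, as a point of the realization of `L`. -/
def toSub : C(subSpace K L, L.space) where
  toFun x := L.mkPoint x.1.1 x.1.2.1 (sum_coord x.1) x.2
  continuous_toFun := continuous_of_coord fun v => by
    change Continuous fun x : subSpace K L => x.1.1 v
    exact (continuous_coord v).comp continuous_subtype_val

variable [DecidableEq V] {c : ℕ} {T : Fin c → Fin 3 → V} (hT : AttachTriangles K L T)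
include hT

omit [Fintype V] in
lemma faces_subset : L.faces ⊆ K.faces := fun s hs => (hT.faces_iff s).2 (Or.inl hs)

omit [Fintype V] in
lemma incl_mem (x : L.space) : incl hT.faces_subset x ∈ subSpace K L := exists_carries x

omit [Fintype V] [DecidableEq V] hT in
lemma continuous_sum_depth : Continuous fun x : K.space => ∑ i, depth (T i) x :=
  continuous_finsetSum _ fun i _ => continuous_depth (T i)

open Classical in
/-- The homotopy on `K` extending a contraction `H` of `L`: it is carried out, at a speed which
decreases with the distance from `L`, on the neighbourhood of `L` which `expand` pushes into `L`. -/
noncomputable def extendFun (q₀ : L.space) (H : unitInterval × L.space → L.space)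
    (q : unitInterval × K.space) : K.space :=
  if ∑ i, depth (T i) q.2 ≤ 1 / 6 then
    incl hT.faces_subset (H (q.1 * Set.projIcc 0 1 zero_le_one (1 - 6 * ∑ i, depth (T i) q.2),
      if h : hT.expand q.2 ∈ subSpace K L then toSub ⟨_, h⟩ else q₀))
  else hT.expand q.2

lemma mem_of_sum_depth_le {x : K.space} (h : ∑ i, depth (T i) x ≤ 1 / 6) :
    hT.expand x ∈ subSpace K L :=
  hT.expand_mem fun i => le_trans
    (Finset.single_le_sum (fun j _ => depth_nonneg (T j) x) (Finset.mem_univ i)) h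

lemma sum_depth_eq_zero {x : K.space} (h : x ∈ subSpace K L) : ∑ i, depth (T i) x = 0 :=
  Finset.sum_eq_zero fun i _ => hT.mem_subSpace_iff.1 h i

variable (q₀ : L.space)

lemma extendFun_of_le {H : unitInterval × L.space → L.space} {q : unitInterval × K.space}
    (h : ∑ i, depth (T i) q.2 ≤ 1 / 6) : hT.extendFun q₀ H q =
      incl hT.faces_subset (H (q.1 * Set.projIcc 0 1 zero_le_one (1 - 6 * ∑ i, depth (T i) q.2),
        toSub ⟨_, hT.mem_of_sum_depth_le h⟩)) := by
  rw [extendFun, if_pos h, dif_pos (hT.mem_of_sum_depth_le h)]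

lemma extendFun_of_fixed {H : unitInterval × L.space → L.space} {q : unitInterval × K.space}
    (h : ∑ i, depth (T i) q.2 ≤ 1 / 6 →
      q.1 * Set.projIcc 0 1 zero_le_one (1 - 6 * ∑ i, depth (T i) q.2) = 0)
    (hH : ∀ x, H (0, x) = x) : hT.extendFun q₀ H q = hT.expand q.2 := by
  by_cases h' : ∑ i, depth (T i) q.2 ≤ 1 / 6
  · rw [extendFun_of_le _ _ h', h h', hH]
    exact Subtype.ext rfl
  · exact if_neg h'

lemma extendFun_mem {H : unitInterval × L.space → L.space} {q : unitInterval × K.space}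
    (h : q.2 ∈ subSpace K L) : hT.extendFun q₀ H q ∈ subSpace K L := by
  rw [extendFun_of_le _ _ (by rw [hT.sum_depth_eq_zero h]; norm_num)]
  exact hT.incl_mem _

lemma continuous_extendFun {H : unitInterval × L.space → L.space} (hc : Continuous H)
    (hH : ∀ x, H (0, x) = x) : Continuous (hT.extendFun q₀ H) := by
  classical
  have hd : Continuous fun q : unitInterval × K.space => ∑ i, depth (T i) q.2 :=
    continuous_sum_depth.comp continuous_snd
  have he : Continuous fun q : unitInterval × K.space => hT.expand q.2 :=
    hT.expand.continuous.comp continuous_snd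
  refine continuous_if_le hd continuous_const ?_ he.continuousOn fun q hq => ?_
  · rw [continuousOn_iff_continuous_domRestrict]
    have : Set.domRestrict {q : unitInterval × K.space | ∑ i, depth (T i) q.2 ≤ 1 / 6} (fun q =>
        incl hT.faces_subset (H (q.1 * Set.projIcc 0 1 zero_le_one (1 - 6 * ∑ i, depth (T i) q.2),
          if h : hT.expand q.2 ∈ subSpace K L then toSub ⟨_, h⟩ else q₀))) = fun q =>
        incl hT.faces_subset
          (H (q.1.1 * Set.projIcc 0 1 zero_le_one (1 - 6 * ∑ i, depth (T i) q.1.2),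
            toSub ⟨_, hT.mem_of_sum_depth_le q.2⟩)) := by
      funext q
      exact congrArg (fun z => incl hT.faces_subset (H (_, z)))
        (dif_pos (hT.mem_of_sum_depth_le q.2))
    rw [this]
    refine (incl _).continuous.comp (hc.comp (Continuous.prodMk ?_ ?_))
    · refine (continuous_fst.comp continuous_subtype_val).mul (continuous_projIcc.comp ?_)
      exact continuous_const.sub (continuous_const.mul (hd.comp continuous_subtype_val))
    · exact toSub.continuous.comp
        (Continuous.subtype_mk (he.comp continuous_subtype_val) _)
  · have := hT.extendFun_of_fixed q₀ (q := q) (fun _ => ?_) hH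
    · rwa [extendFun, if_pos hq.le] at this
    · rw [hq, Set.projIcc_of_le_left zero_le_one (by norm_num)]
      exact mul_zero _

/-- A complex obtained from a contractible complex by attaching `c` triangles is homotopy
equivalent to a wedge of `c` two-dimensional spheres. -/
theorem hEquivTop_wedgeSph [ContractibleSpace L.space] : K.HEquivTop (WedgeSph 2 c) := by
  obtain ⟨q₀, ⟨H⟩⟩ := id_nullhomotopic L.space
  have hH : ∀ x, H (0, x) = x := H.map_zero_left
  have hH1 : ∀ x, H (1, x) = q₀ := H.map_one_left
  have hc := hT.continuous_extendFun q₀ H.continuous hH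
  let φ : C(K.space, K.space) :=
    ⟨fun x => hT.extendFun q₀ H (1, x), hc.comp (by fun_prop)⟩
  let P : C(K.space, K.space) → Prop := fun g => ∀ x ∈ subSpace K L, g x ∈ subSpace K L
  have hl : ∀ x, ∃ s ∈ K.faces,
      Carries s (ContinuousMap.id K.space x) ∧ Carries s (hT.expand x) := fun x => by
    obtain ⟨s, hs, hx⟩ := exists_carries x
    exact ⟨s, hs, hx, hT.carries_expand hx⟩
  let Φ₁ : ContinuousMap.HomotopyWith (.id K.space) hT.expand P :=
    { lineHomotopy (.id K.space) hT.expand hl with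
      prop' := by
        rintro t x ⟨s, hs, hx⟩
        exact ⟨s, hs, carries_lineHomotopy hl hx (hT.carries_expand hx) t⟩ }
  let Φ₂ : ContinuousMap.HomotopyWith hT.expand φ P :=
    { toFun := hT.extendFun q₀ H
      continuous_toFun := hc
      map_zero_left := fun x => hT.extendFun_of_fixed q₀ (fun _ => zero_mul _) hH
      map_one_left := fun x => rfl
      prop' := fun t x hx => hT.extendFun_mem q₀ hx }
  refine homotopyEquiv_wedge_of_collapse (subSpace K L) (incl hT.faces_subset q₀) (hT.incl_mem q₀)
    hT.param ⟨_, hT.continuous_collapseFun⟩ (fun x => ?_) (fun i y h => hT.param_mem_subSpace h)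
    (fun x hx => hT.collapseFun_of_mem hx) (fun i y => ?_) φ (fun x hx => ?_) (Φ₁.trans Φ₂)
  · rcases hT.mem_subSpace_or x with h | ⟨i, h⟩
    exacts [Or.inl h, Or.inr ⟨i, _, hT.eq_param (hT.carries_image h)⟩]
  · refine (hT.collapseFun_of_carries (hT.carries_param i y)).trans ?_
    congr
    exact funext (hT.param_coord i y)
  · refine (hT.extendFun_of_le q₀ (by rw [hT.sum_depth_eq_zero hx]; norm_num)).trans ?_
    congr 1
    refine Eq.trans (congrArg H ?_) (hH1 (toSub ⟨_, hT.mem_of_sum_depth_le (x := x) ?_⟩))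
    · refine Prod.ext ?_ rfl
      change 1 * Set.projIcc (0 : ℝ) 1 zero_le_one (1 - 6 * ∑ i, depth (T i) x) = 1
      rw [hT.sum_depth_eq_zero hx, Set.projIcc_of_right_le zero_le_one (by norm_num)]
      exact mul_one _
    · rw [hT.sum_depth_eq_zero hx]; norm_num

end AbsSC.AttachTriangles

namespace AbsSC

/-- The continuous map into a realization obtained by normalizing nonnegative coordinates. -/
noncomputable def normMap {V X : Type} [Fintype V] [TopologicalSpace X] (K : AbsSC V)
    (F : X → V → ℝ) (hF : ∀ v, Continuous fun x => F x v) (h0 : ∀ x v, 0 ≤ F x v)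
    (hpos : ∀ x, ∃ v, F x v ≠ 0) (hs : ∀ x, ∃ s ∈ K.faces, ∀ v, F x v ≠ 0 → v ∈ s) :
    C(X, K.space) :=
  have hN : ∀ x, ∑ v, F x v ≠ 0 := fun x => by
    obtain ⟨v, hv⟩ := hpos x
    exact (Finset.sum_pos' (fun v _ => h0 x v)
      ⟨v, mem_univ v, lt_of_le_of_ne (h0 x v) hv.symm⟩).ne'
  { toFun := fun x => K.mkPoint (fun v => F x v / ∑ u, F x u)
      (fun v => div_nonneg (h0 x v) (Finset.sum_nonneg fun u _ => h0 x u))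
      (by rw [← Finset.sum_div, div_self (hN x)])
      (by
        obtain ⟨s, hs, h⟩ := hs x
        exact ⟨s, hs, fun v hv => h v fun h' => hv (by rw [h', zero_div])⟩)
    continuous_toFun := continuous_of_coord fun v =>
      (hF v).div (continuous_finsetSum _ fun u _ => hF u) hN }

lemma carries_normMap {V X : Type} [Fintype V] [TopologicalSpace X] {K : AbsSC V}
    {F : X → V → ℝ} {hF : ∀ v, Continuous fun x => F x v} {h0 : ∀ x v, 0 ≤ F x v}
    {hpos : ∀ x, ∃ v, F x v ≠ 0} {hs : ∀ x, ∃ s ∈ K.faces, ∀ v, F x v ≠ 0 → v ∈ s}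
    {x : X} {s : Finset V} (h : ∀ v, F x v ≠ 0 → v ∈ s) :
    Carries s (K.normMap F hF h0 hpos hs x) := by
  intro v hv
  refine h v fun h' => hv ?_
  change F x v / ∑ u, F x u = 0
  rw [h', zero_div]

end AbsSC

/-- The pairs `(y, x)` with `y < x` and `x ∈ A`, regarded as the edges of a graph. -/
def edgeSet (A : Finset ℕ) : Finset (ℕ × ℕ) :=
  A.biUnion fun x => (range x).image fun y => (y, x)

/-- The type of edges of the graph determined by `A`. -/
abbrev Edge (A : Finset ℕ) : Type := edgeSet A

namespace Edge

variable {A : Finset ℕ}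

lemma mem_edgeSet {p : ℕ × ℕ} : p ∈ edgeSet A ↔ p.1 < p.2 ∧ p.2 ∈ A := by
  rcases p with ⟨y, x⟩
  simp only [edgeSet, mem_biUnion, mem_image, mem_range, Prod.mk.injEq]
  constructor
  · rintro ⟨x', hx', y', hy, rfl, rfl⟩
    exact ⟨hy, hx'⟩
  · rintro ⟨h, hx⟩
    exact ⟨x, hx, y, h, rfl, rfl⟩

lemma lt (e : Edge A) : e.1.1 < e.1.2 := (mem_edgeSet.1 e.2).1

lemma snd_mem (e : Edge A) : e.1.2 ∈ A := (mem_edgeSet.1 e.2).2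

/-- The edge `e` has the endpoint `u`. -/
def Inc (u : ℕ) (e : Edge A) : Prop := u = e.1.1 ∨ u = e.1.2

instance (u : ℕ) : DecidablePred (Inc u : Edge A → Prop) := fun _ => instDecidableOr

/-- The edges at the vertex `u`. -/
def star (A : Finset ℕ) (u : ℕ) : Finset (Edge A) := univ.filter (Inc u)

lemma mem_star {u : ℕ} {e : Edge A} : e ∈ star A u ↔ Inc u e := by simp [star]

/-- The edges of the triangle spanned by the edge `f` and the vertex `w`. -/
def coneTri (w : ℕ) (f : Edge A) : Finset (Edge A) :=
  univ.filter fun e => e = f ∨ e.1 = (f.1.1, w) ∨ e.1 = (f.1.2, w)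

lemma mem_coneTri {w : ℕ} {e f : Edge A} :
    e ∈ coneTri w f ↔ e = f ∨ e.1 = (f.1.1, w) ∨ e.1 = (f.1.2, w) := by simp [coneTri]

/-- The complex on the edges whose facets are the stars of the vertices and the triangles
containing the vertex `w`. -/
def coneComplex (A : Finset ℕ) (w : ℕ) : AbsSC (Edge A) where
  faces := {σ | σ ≠ ∅ ∧ ((∃ u, σ ⊆ star A u) ∨ ∃ f : Edge A, f.1.2 ≠ w ∧ σ ⊆ coneTri w f)}
  not_empty_mem h := h.1 rfl
  down_closed := by
    rintro s ⟨-, hs⟩ t hts htne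
    refine ⟨htne, hs.imp ?_ ?_⟩
    · rintro ⟨u, hu⟩
      exact ⟨u, hts.trans hu⟩
    · rintro ⟨f, hf, hs⟩
      exact ⟨f, hf, hts.trans hs⟩

lemma Inc.eq_of_ne {a b : Edge A} (hab : a ≠ b) {u v : ℕ} (ha : Inc u a) (hb : Inc u b)
    (ha' : Inc v a) (hb' : Inc v b) : u = v := by
  by_contra huv
  refine hab (Subtype.ext (Prod.ext ?_ ?_)) <;>
  · have h1 := a.lt
    have h2 := b.lt
    simp only [Inc] at *
    omega

end Edge

namespace Edge

open AbsSC

variable {A : Finset ℕ} {w : ℕ}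

lemma carries_cases (x : (coneComplex A w).space) :
    (∃ u, Carries (star A u) x) ∨ ∃ f : Edge A, f.1.2 ≠ w ∧ Carries (coneTri w f) x := by
  obtain ⟨s, ⟨-, hs⟩, hx⟩ := exists_carries x
  refine hs.imp ?_ ?_
  · rintro ⟨u, hu⟩
    exact ⟨u, fun v hv => hu (hx v hv)⟩
  · rintro ⟨f, hf, hu⟩
    exact ⟨f, hf, fun v hv => hu (hx v hv)⟩

lemma exists_ne_zero (x : (coneComplex A w).space) : ∃ e, x.1 e ≠ 0 := by
  by_contra! h
  have := sum_coord x
  rw [Finset.sum_eq_zero fun e _ => h e] at this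
  exact zero_ne_one this

lemma face_star {x : (coneComplex A w).space} {u : ℕ} (h : Carries (star A u) x) :
    star A u ∈ (coneComplex A w).faces := by
  obtain ⟨e, he⟩ := exists_ne_zero x
  exact ⟨Finset.ne_empty_of_mem (h e he), Or.inl ⟨u, subset_rfl⟩⟩

lemma face_coneTri {f : Edge A} (h : f.1.2 ≠ w) : coneTri w f ∈ (coneComplex A w).faces :=
  ⟨Finset.ne_empty_of_mem (mem_coneTri.2 (Or.inl rfl)), Or.inr ⟨f, h, subset_rfl⟩⟩

/-- Unnormalized coordinates of a map pushing every point towards a triangle containing `w` or the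
star of `w`. -/
noncomputable def spreadFun (x : (coneComplex A w).space) (e : Edge A) : ℝ :=
  if e.1.2 = w then
    x.1 e + ∑ a, ∑ b, if a ≠ b ∧ Inc e.1.1 a ∧ Inc e.1.1 b then x.1 a * x.1 b else 0
  else max (2 * x.1 e - 1) 0

lemma spreadFun_nonneg (x : (coneComplex A w).space) (e : Edge A) : 0 ≤ spreadFun x e := by
  unfold spreadFun
  split_ifs
  · refine add_nonneg (x.2.1 e) (Finset.sum_nonneg fun a _ => Finset.sum_nonneg fun b _ => ?_)
    split_ifs
    exacts [mul_nonneg (x.2.1 a) (x.2.1 b), le_rfl]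
  · exact le_max_right _ _

lemma continuous_spreadFun (e : Edge A) :
    Continuous fun x : (coneComplex A w).space => spreadFun x e := by
  unfold spreadFun
  by_cases h : e.1.2 = w
  · simp only [h, if_true]
    refine (continuous_coord e).add
      (continuous_finsetSum _ fun a _ => continuous_finsetSum _ fun b _ => ?_)
    by_cases h' : a ≠ b ∧ Inc e.1.1 a ∧ Inc e.1.1 b
    · simp only [if_pos h']
      exact (continuous_coord a).mul (continuous_coord b)
    · simp only [if_neg h']
      exact continuous_const
  · simp only [h, if_false]
    exact ((continuous_const.mul (continuous_coord e)).sub continuous_const).max continuous_const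

lemma half_lt_of_spreadFun {x : (coneComplex A w).space} {e : Edge A} (he : e.1.2 ≠ w)
    (h : spreadFun x e ≠ 0) : 1 / 2 < x.1 e := by
  rw [spreadFun, if_neg he] at h
  by_contra h'
  exact h (max_eq_right (by linarith))

lemma of_spreadFun_ne_zero {x : (coneComplex A w).space} {e : Edge A} (h : spreadFun x e ≠ 0) :
    x.1 e ≠ 0 ∨ (e.1.2 = w ∧
      ∃ a b, a ≠ b ∧ Inc e.1.1 a ∧ Inc e.1.1 b ∧ x.1 a ≠ 0 ∧ x.1 b ≠ 0) := by
  by_cases he : e.1.2 = w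
  · rw [spreadFun, if_pos he] at h
    by_contra! h'
    refine h ?_
    rw [h'.1, zero_add]
    refine Finset.sum_eq_zero fun a _ => Finset.sum_eq_zero fun b _ => ?_
    split_ifs with hab
    · by_cases ha : x.1 a = 0
      · rw [ha, zero_mul]
      · rw [h'.2 he a b hab.1 hab.2.1 hab.2.2 ha, mul_zero]
    · rfl
  · exact Or.inl (by linarith [half_lt_of_spreadFun he h] : (0 : ℝ) < _).ne'

lemma spreadFun_mem_star {x : (coneComplex A w).space} {u : ℕ} (hx : Carries (star A u) x)
    {e : Edge A} (h : spreadFun x e ≠ 0) : e ∈ star A u := by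
  rcases of_spreadFun_ne_zero h with h | ⟨-, a, b, hab, ha, hb, ha', hb'⟩
  · exact hx e h
  · rw [mem_star, Inc.eq_of_ne hab (mem_star.1 (hx a ha')) (mem_star.1 (hx b hb')) ha hb]
    exact Or.inl rfl

lemma spreadFun_mem_coneTri {x : (coneComplex A w).space} {f : Edge A}
    (hx : Carries (coneTri w f) x) {e : Edge A} (h : spreadFun x e ≠ 0) : e ∈ coneTri w f := by
  rcases of_spreadFun_ne_zero h with h | ⟨he, a, b, hab, ha, hb, ha', hb'⟩
  · exact hx e h
  · have h1 := mem_coneTri.1 (hx a ha')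
    have h2 := mem_coneTri.1 (hx b hb')
    have h3 := e.lt
    have h4 := f.lt
    simp only [mem_coneTri, Inc, Subtype.ext_iff, Prod.ext_iff, ne_eq] at *
    omega

variable (hw : ∀ x ∈ A, x ≤ w) (hwA : w ∈ A)
include hw hwA

lemma exists_spreadFun_ne_zero (x : (coneComplex A w).space) : ∃ e, spreadFun x e ≠ 0 := by
  by_contra! h
  have hout : ∀ e : Edge A, e.1.2 = w → x.1 e = 0 := by
    intro e he
    have h1 := h e
    rw [spreadFun, if_pos he] at h1
    refine le_antisymm ?_ (x.2.1 e)
    refine le_trans (le_add_of_nonneg_right ?_) h1.le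
    refine Finset.sum_nonneg fun a _ => Finset.sum_nonneg fun b _ => ?_
    split_ifs
    exacts [mul_nonneg (x.2.1 a) (x.2.1 b), le_rfl]
  have hpair : ∀ (u : ℕ) (a b : Edge A), a ≠ b → Inc u a → Inc u b → x.1 a ≠ 0 → x.1 b = 0 := by
    intro u a b hab ha hb ha'
    by_contra hb'
    have hu : u < w := by
      have ha1 : a.1.2 ≠ w := fun h => ha' (hout a h)
      have := hw _ a.snd_mem
      have := a.lt
      rcases ha with ha | ha <;> omega
    have he : (u, w) ∈ edgeSet A := mem_edgeSet.2 ⟨hu, hwA⟩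
    have h1 := h ⟨(u, w), he⟩
    rw [spreadFun, if_pos rfl, hout _ rfl, zero_add] at h1
    have h0 : ∀ a b : Edge A, (0 : ℝ) ≤ if a ≠ b ∧ Inc u a ∧ Inc u b then x.1 a * x.1 b else 0 := by
      intro a b
      split_ifs
      exacts [mul_nonneg (x.2.1 a) (x.2.1 b), le_rfl]
    have h2 := (Finset.sum_eq_zero_iff_of_nonneg
      fun a _ => Finset.sum_nonneg fun b _ => h0 a b).1 h1 a (mem_univ a)
    have h3 := (Finset.sum_eq_zero_iff_of_nonneg fun b _ => h0 a b).1 h2 b (mem_univ b)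
    rw [if_pos ⟨hab, ha, hb⟩] at h3
    exact (mul_ne_zero ha' hb') h3
  obtain ⟨e, he⟩ := exists_ne_zero x
  have hsingle : ∀ b, b ≠ e → x.1 b = 0 := by
    intro b hb
    rcases carries_cases x with ⟨u, hu⟩ | ⟨f, -, hf⟩
    · by_contra hb'
      exact hb' (hpair u e b hb.symm (mem_star.1 (hu e he)) (mem_star.1 (hu b hb')) he)
    · have key : ∀ a, x.1 a ≠ 0 → a = f := fun a ha => by
        rcases mem_coneTri.1 (hf a ha) with h | h | h
        · exact h
        · exact (ha (hout a (by rw [h]))).elim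
        · exact (ha (hout a (by rw [h]))).elim
      by_contra hb'
      exact hb ((key b hb').trans (key e he).symm)
  have hsum := sum_coord x
  have hx1 : x.1 e = 1 := by
    refine Eq.trans ?_ hsum
    exact (Finset.sum_eq_single e (fun b _ hb => hsingle b hb) (by simp)).symm
  have h1 := h e
  rw [spreadFun, if_neg fun h => he (hout e h), hx1] at h1
  norm_num at h1

/-- The map of `coneComplex A w` into itself given by `spreadFun`. -/
noncomputable def spread : C((coneComplex A w).space, (coneComplex A w).space) :=
  (coneComplex A w).normMap spreadFun continuous_spreadFun spreadFun_nonneg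
    (exists_spreadFun_ne_zero hw hwA) fun x => by
      rcases carries_cases x with ⟨u, hu⟩ | ⟨f, hf, hfx⟩
      exacts [⟨_, face_star hu, fun v hv => spreadFun_mem_star hu hv⟩,
        ⟨_, face_coneTri hf, fun v hv => spreadFun_mem_coneTri hfx hv⟩]

lemma exists_common_face_spread (x : (coneComplex A w).space) : ∃ s ∈ (coneComplex A w).faces,
    Carries s x ∧ Carries s (spread hw hwA x) := by
  rcases carries_cases x with ⟨u, hu⟩ | ⟨f, hf, hfx⟩
  exacts [⟨_, face_star hu, hu, carries_normMap fun v hv => spreadFun_mem_star hu hv⟩,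
    ⟨_, face_coneTri hf, hfx, carries_normMap fun v hv => spreadFun_mem_coneTri hfx hv⟩]

lemma carries_spread (x : (coneComplex A w).space) : Carries (star A w) (spread hw hwA x) ∨
    ∃ f : Edge A, f.1.2 ≠ w ∧ Carries (coneTri w f) (spread hw hwA x) := by
  by_cases h : ∃ f : Edge A, f.1.2 ≠ w ∧ spreadFun x f ≠ 0
  · obtain ⟨f, hf, hfx⟩ := h
    have hx := half_lt_of_spreadFun hf hfx
    refine Or.inr ⟨f, hf, carries_normMap fun e he => ?_⟩
    by_cases he' : e.1.2 = w
    · rw [mem_coneTri]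
      have hlt := hw _ f.snd_mem
      have hel := e.lt
      have hfl := f.lt
      rcases carries_cases x with ⟨u, hu⟩ | ⟨f', hf', hfx'⟩
      · have h1 := mem_star.1 (spreadFun_mem_star hu he)
        have h2 := mem_star.1 (spreadFun_mem_star hu hfx)
        simp only [Inc, Subtype.ext_iff, Prod.ext_iff] at *
        omega
      · have h1 := mem_coneTri.1 (spreadFun_mem_coneTri hfx' he)
        have h2 := mem_coneTri.1 (spreadFun_mem_coneTri hfx' hfx)
        simp only [Subtype.ext_iff, Prod.ext_iff] at *
        omega
    · have hx' := half_lt_of_spreadFun he' he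
      refine mem_coneTri.2 (Or.inl ?_)
      by_contra hef
      have h1 : x.1 e + x.1 f ≤ ∑ v, x.1 v := by
        rw [← Finset.sum_pair hef]
        exact Finset.sum_le_sum_of_subset_of_nonneg (Finset.subset_univ _) fun v _ _ => x.2.1 v
      have h2 := sum_coord x
      linarith [h1.trans h2.le]
  · push Not at h
    refine Or.inl (carries_normMap fun e he => mem_star.2 (Or.inr ?_))
    by_contra h'
    exact he (h e (Ne.symm h'))

end Edge

namespace Edge

open AbsSC

variable {A : Finset ℕ} {w : ℕ}

/-- Unnormalized coordinates of the projection of a triangle containing `w` to its edges at `w`. -/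
noncomputable def pushFun (x : (coneComplex A w).space) (e : Edge A) : ℝ :=
  if e.1.2 = w then x.1 e + ∑ f, if f.1.2 ≠ w ∧ Inc e.1.1 f then x.1 f else 0 else 0

lemma pushFun_term_nonneg (x : (coneComplex A w).space) (u : ℕ) (f : Edge A) :
    0 ≤ if f.1.2 ≠ w ∧ Inc u f then x.1 f else 0 := by
  split_ifs
  exacts [x.2.1 f, le_rfl]

lemma pushFun_nonneg (x : (coneComplex A w).space) (e : Edge A) : 0 ≤ pushFun x e := by
  unfold pushFun
  split_ifs
  exacts [add_nonneg (x.2.1 e) (Finset.sum_nonneg fun f _ => pushFun_term_nonneg x _ f), le_rfl]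

lemma continuous_pushFun (e : Edge A) :
    Continuous fun x : (coneComplex A w).space => pushFun x e := by
  unfold pushFun
  by_cases h : e.1.2 = w
  · simp only [h, if_true]
    refine (continuous_coord e).add (continuous_finsetSum _ fun f _ => ?_)
    by_cases h' : f.1.2 ≠ w ∧ Inc e.1.1 f
    · simp only [if_pos h']
      exact continuous_coord f
    · simp only [if_neg h']
      exact continuous_const
  · simp only [h, if_false]
    exact continuous_const

lemma pushFun_mem_star {x : (coneComplex A w).space} {e : Edge A} (h : pushFun x e ≠ 0) :
    e ∈ star A w := by
  refine mem_star.2 (Or.inr ?_)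
  by_contra h'
  exact h (if_neg (Ne.symm h'))

lemma pushFun_mem_coneTri {x : (coneComplex A w).space} {f : Edge A}
    (hx : Carries (coneTri w f) x) {e : Edge A} (h : pushFun x e ≠ 0) : e ∈ coneTri w f := by
  have he : e.1.2 = w := by
    by_contra h'
    exact h (if_neg h')
  rw [pushFun, if_pos he] at h
  by_cases hxe : x.1 e = 0
  · rw [hxe, zero_add] at h
    obtain ⟨f', -, hf'⟩ := Finset.exists_ne_zero_of_sum_ne_zero h
    have hc : f'.1.2 ≠ w ∧ Inc e.1.1 f' := by
      by_contra hc
      exact hf' (if_neg hc)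
    rw [if_pos hc] at hf'
    have h1 := mem_coneTri.1 (hx f' hf')
    simp only [mem_coneTri, Inc, Subtype.ext_iff, Prod.ext_iff, ne_eq] at *
    omega
  · exact hx e hxe

variable (hw : ∀ x ∈ A, x ≤ w) (hwA : w ∈ A)
include hw hwA

lemma exists_pushFun_ne_zero (x : (coneComplex A w).space) : ∃ e, pushFun x e ≠ 0 := by
  obtain ⟨f, hf⟩ := exists_ne_zero x
  have hpos : 0 < x.1 f := lt_of_le_of_ne (x.2.1 f) hf.symm
  by_cases hfw : f.1.2 = w
  · refine ⟨f, ?_⟩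
    rw [pushFun, if_pos hfw]
    exact (add_pos_of_pos_of_nonneg hpos
      (Finset.sum_nonneg fun f _ => pushFun_term_nonneg x _ f)).ne'
  · have he : (f.1.1, w) ∈ edgeSet A :=
      mem_edgeSet.2 ⟨f.lt.trans_le (hw _ f.snd_mem), hwA⟩
    refine ⟨⟨_, he⟩, ?_⟩
    rw [pushFun, if_pos rfl]
    refine (add_pos_of_nonneg_of_pos (x.2.1 _) (hpos.trans_le ?_)).ne'
    refine le_trans ?_ (Finset.single_le_sum (fun g _ => pushFun_term_nonneg x f.1.1 g)
      (Finset.mem_univ f))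
    rw [if_pos ⟨hfw, Or.inl rfl⟩]

/-- The map of `coneComplex A w` to the star of `w` given by `pushFun`. -/
noncomputable def push : C((coneComplex A w).space, (coneComplex A w).space) :=
  (coneComplex A w).normMap pushFun continuous_pushFun pushFun_nonneg
    (exists_pushFun_ne_zero hw hwA) fun x => by
      obtain ⟨e, he⟩ := exists_pushFun_ne_zero hw hwA x
      exact ⟨star A w, ⟨Finset.ne_empty_of_mem (pushFun_mem_star he), Or.inl ⟨w, subset_rfl⟩⟩,
        fun v hv => pushFun_mem_star hv⟩

lemma carries_push (x : (coneComplex A w).space) : Carries (star A w) (push hw hwA x) :=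
  carries_normMap fun _ hv => pushFun_mem_star hv

lemma carries_push_coneTri {x : (coneComplex A w).space} {f : Edge A}
    (hx : Carries (coneTri w f) x) : Carries (coneTri w f) (push hw hwA x) :=
  carries_normMap fun _ hv => pushFun_mem_coneTri hx hv

theorem contractibleSpace_coneComplex (hw0 : 0 < w) :
    ContractibleSpace (coneComplex A w).space := by
  have he : (0, w) ∈ edgeSet A := mem_edgeSet.2 ⟨hw0, hwA⟩
  have hmem : (⟨_, he⟩ : Edge A) ∈ star A w := mem_star.2 (Or.inr rfl)
  have hface : star A w ∈ (coneComplex A w).faces :=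
    ⟨Finset.ne_empty_of_mem hmem, Or.inl ⟨w, subset_rfl⟩⟩
  have hsup : ∀ v, Pi.single (M := fun _ : Edge A => ℝ) ⟨_, he⟩ 1 v ≠ 0 → v ∈ star A w := by
    intro v hv
    by_cases h : v = ⟨_, he⟩
    · rw [h]; exact hmem
    · exact (hv (Pi.single_eq_of_ne h 1)).elim
  let p : (coneComplex A w).space := (coneComplex A w).mkPoint (Pi.single ⟨_, he⟩ 1)
    (fun v => by
      by_cases h : v = ⟨_, he⟩
      · rw [h, Pi.single_eq_same]; exact zero_le_one
      · rw [Pi.single_eq_of_ne h])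
    (by simp) ⟨_, hface, hsup⟩
  rw [contractible_iff_id_nullhomotopic]
  refine ⟨p, ⟨(lineHomotopy (.id _) (spread hw hwA) (exists_common_face_spread hw hwA)).trans
    ((lineHomotopy (spread hw hwA) ((push hw hwA).comp (spread hw hwA)) fun x => ?_).trans
      (lineHomotopy _ (.const _ p) fun x => ⟨_, hface, carries_push hw hwA _, hsup⟩))⟩⟩
  rcases carries_spread hw hwA x with h | ⟨f, hf, h⟩
  · exact ⟨_, hface, h, carries_push hw hwA _⟩
  · exact ⟨_, face_coneTri hf, h, carries_push_coneTri hw hwA h⟩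

end Edge

namespace Edge

open AbsSC

variable {A : Finset ℕ} {w : ℕ}

/-- The complex on the edges whose faces are the sets of pairwise intersecting edges. -/
def shareComplex (A : Finset ℕ) : AbsSC (Edge A) where
  faces := {σ | σ ≠ ∅ ∧ ∀ a ∈ σ, ∀ b ∈ σ, ∃ u, Inc u a ∧ Inc u b}
  not_empty_mem h := h.1 rfl
  down_closed := by
    rintro s ⟨-, hs⟩ t hts htne
    exact ⟨htne, fun a ha b hb => hs a (hts ha) b (hts hb)⟩

/-- Pairwise intersecting edges without a common vertex form a triangle. -/
lemma exists_triangle {σ : Finset (Edge A)} (hne : σ ≠ ∅)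
    (h : ∀ a ∈ σ, ∀ b ∈ σ, ∃ u, Inc u a ∧ Inc u b) (hstar : ∀ u, ¬ σ ⊆ star A u) :
    ∃ y x z, y < x ∧ x < z ∧ ∃ a ∈ σ, ∃ b ∈ σ, ∃ c ∈ σ,
      a.1 = (y, x) ∧ b.1 = (y, z) ∧ c.1 = (x, z) ∧ ∀ d ∈ σ, d = a ∨ d = b ∨ d = c := by
  obtain ⟨a, ha⟩ := Finset.nonempty_iff_ne_empty.2 hne
  obtain ⟨b, hb, hb'⟩ := Finset.not_subset.1 (hstar a.1.1)
  obtain ⟨c, hc, hc'⟩ := Finset.not_subset.1 (hstar a.1.2)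
  rw [mem_star] at hb' hc'
  obtain ⟨r, hrb, hrc⟩ := h b hb c hc
  have hqb : Inc a.1.2 b := by
    obtain ⟨u, rfl | rfl, hu⟩ := h a ha b hb
    exacts [(hb' hu).elim, hu]
  have hpc : Inc a.1.1 c := by
    obtain ⟨u, rfl | rfl, hu⟩ := h a ha c hc
    exacts [hu, (hc' hu).elim]
  have hrp : r ≠ a.1.1 := fun h => hb' (h ▸ hrb)
  have hrq : r ≠ a.1.2 := fun h => hc' (h ▸ hrc)
  have hd : ∀ d ∈ σ, d = a ∨ d = b ∨ d = c := by
    intro d hd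
    have hpq : ∃ u v, u ≠ v ∧ Inc u d ∧ Inc v d ∧
        ((Inc u a ∧ Inc v a) ∨ (Inc u b ∧ Inc v b) ∨ (Inc u c ∧ Inc v c)) := by
      have hbr : ∀ u, Inc u b → u = a.1.2 ∨ u = r := fun u hu => by
        by_contra! hne
        simp only [Inc] at hu hqb hrb
        omega
      have hcr : ∀ u, Inc u c → u = a.1.1 ∨ u = r := fun u hu => by
        by_contra! hne
        simp only [Inc] at hu hpc hrc
        omega
      obtain ⟨j, hj, hjd⟩ := h b hb d hd
      obtain ⟨k, hk, hkd⟩ := h c hc d hd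
      rcases hbr j hj with rfl | rfl <;> rcases hcr k hk with rfl | rfl
      · exact ⟨_, _, a.lt.ne', hjd, hkd, Or.inl ⟨Or.inr rfl, Or.inl rfl⟩⟩
      · exact ⟨_, _, hrq.symm, hjd, hkd, Or.inr (Or.inl ⟨hqb, hrb⟩)⟩
      · exact ⟨_, _, hrp, hjd, hkd, Or.inr (Or.inr ⟨hrc, hpc⟩)⟩
      · obtain ⟨i, hi | hi, hid⟩ := h a ha d hd
        · exact ⟨_, _, hrp, hjd, hi ▸ hid, Or.inr (Or.inr ⟨hrc, hpc⟩)⟩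
        · exact ⟨_, _, hrq, hjd, hi ▸ hid, Or.inr (Or.inl ⟨hrb, hqb⟩)⟩
    obtain ⟨u, v, huv, hud, hvd, h⟩ := hpq
    by_contra! hne
    rcases h with h | h | h
    · exact huv (Inc.eq_of_ne hne.1 hud h.1 hvd h.2)
    · exact huv (Inc.eq_of_ne hne.2.1 hud h.1 hvd h.2)
    · exact huv (Inc.eq_of_ne hne.2.2 hud h.1 hvd h.2)
  have h2 := b.lt
  have h3 := c.lt
  have h1 := a.lt
  simp only [Inc] at hrb hqb hrc hpc
  rcases lt_or_gt_of_ne hrp with hlt | hgt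
  · exact ⟨r, a.1.1, a.1.2, hlt, h1, c, hc, b, hb, a, ha, Prod.ext (by omega) (by omega),
      Prod.ext (by omega) (by omega), rfl, fun d h => by have := hd d h; tauto⟩
  rcases lt_or_gt_of_ne hrq with hlt | hgt'
  · exact ⟨a.1.1, r, a.1.2, hgt, hlt, c, hc, a, ha, b, hb, Prod.ext (by omega) (by omega), rfl,
      Prod.ext (by omega) (by omega), fun d h => by have := hd d h; tauto⟩
  · exact ⟨a.1.1, a.1.2, r, h1, hgt', a, ha, c, hc, b, hb, rfl, Prod.ext (by omega) (by omega),
      Prod.ext (by omega) (by omega), fun d h => by have := hd d h; tauto⟩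

/-- The triangles of the graph which do not contain the vertex `w`, as triples
`(y, (x, z))` with `y < x < z`. -/
def triSet (A : Finset ℕ) (w : ℕ) : Finset (ℕ × ℕ × ℕ) :=
  ((A.erase w ×ˢ A.erase w).filter fun p => p.1 < p.2).biUnion
    fun p => (range p.1).image fun y => (y, p)

lemma mem_triSet {p : ℕ × ℕ × ℕ} : p ∈ triSet A w ↔
    p.1 < p.2.1 ∧ p.2.1 < p.2.2 ∧ p.2.1 ∈ A.erase w ∧ p.2.2 ∈ A.erase w := by
  rcases p with ⟨y, p⟩
  simp only [triSet, mem_biUnion, mem_image, mem_range, Prod.mk.injEq, mem_filter, mem_product]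
  constructor
  · rintro ⟨p', ⟨⟨h1, h2⟩, h3⟩, y', hy, rfl, rfl⟩
    exact ⟨hy, h3, h1, h2⟩
  · rintro ⟨h, h3, h1, h2⟩
    exact ⟨p, ⟨⟨h1, h2⟩, h3⟩, y, h, rfl, rfl⟩

/-- The three edges of a triangle. -/
def triEdges (p : triSet A w) : Fin 3 → Edge A :=
  have h := mem_triSet.1 p.2
  ![⟨(p.1.1, p.1.2.1), mem_edgeSet.2 ⟨h.1, mem_of_mem_erase h.2.2.1⟩⟩,
    ⟨(p.1.1, p.1.2.2), mem_edgeSet.2 ⟨h.1.trans h.2.1, mem_of_mem_erase h.2.2.2⟩⟩,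
    ⟨p.1.2, mem_edgeSet.2 ⟨h.2.1, mem_of_mem_erase h.2.2.2⟩⟩]

lemma mem_image_triEdges {p : triSet A w} {e : Edge A} : e ∈ univ.image (triEdges p) ↔
    e.1 = (p.1.1, p.1.2.1) ∨ e.1 = (p.1.1, p.1.2.2) ∨ e.1 = p.1.2 := by
  simp only [mem_image, mem_univ, true_and, Fin.exists_fin_succ, triEdges]
  simp [Subtype.ext_iff, eq_comm]

lemma attachTriangles (hw : ∀ x ∈ A, x ≤ w) :
    AttachTriangles (shareComplex A) (coneComplex A w)
      fun i => triEdges ((triSet A w).equivFin.symm i) where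
  injective i := by
    set p := (triSet A w).equivFin.symm i
    have h := mem_triSet.1 p.2
    intro j k hjk
    have h' := congrArg Subtype.val hjk
    fin_cases j <;> fin_cases k <;> simp [triEdges, Prod.ext_iff] at h' ⊢ <;> omega
  faces_iff s := by
    constructor
    · rintro ⟨hne, hs⟩
      by_cases hst : ∃ u, s ⊆ star A u
      · exact Or.inl ⟨hne, Or.inl hst⟩
      push Not at hst
      obtain ⟨y, x, z, hyx, hxz, a, ha, b, hb, c, hc, ea, eb, ec, hd⟩ :=
        exists_triangle hne hs hst
      have hz := hw _ c.snd_mem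
      rw [ec] at hz
      by_cases hzw : z = w
      · refine Or.inl ⟨hne, Or.inr ⟨a, ?_, fun d h => ?_⟩⟩
        · rw [ea]; exact (hxz.trans_le hz).ne
        · rw [mem_coneTri]
          rcases hd d h with rfl | rfl | rfl
          · exact Or.inl rfl
          · exact Or.inr (Or.inl (by rw [eb, ea, hzw]))
          · exact Or.inr (Or.inr (by rw [ec, ea, hzw]))
      · have hxA := a.snd_mem
        have hzA := b.snd_mem
        rw [ea] at hxA
        rw [eb] at hzA
        have hp : (y, x, z) ∈ triSet A w := mem_triSet.2
          ⟨hyx, hxz, mem_erase.2 ⟨(hxz.trans_le hz).ne, hxA⟩, mem_erase.2 ⟨hzw, hzA⟩⟩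
        refine Or.inr ⟨(triSet A w).equivFin ⟨_, hp⟩, ?_⟩
        ext d
        rw [Equiv.symm_apply_apply, mem_image_triEdges]
        constructor
        · intro h
          rcases hd d h with rfl | rfl | rfl
          exacts [Or.inl ea, Or.inr (Or.inl eb), Or.inr (Or.inr ec)]
        · rintro (h | h | h)
          · rwa [Subtype.ext (h.trans ea.symm)]
          · rwa [Subtype.ext (h.trans eb.symm)]
          · rwa [Subtype.ext (h.trans ec.symm)]
    · rintro (⟨hne, ⟨u, hu⟩ | ⟨f, -, hf⟩⟩ | ⟨i, rfl⟩)
      · exact ⟨hne, fun a ha b hb => ⟨u, mem_star.1 (hu ha), mem_star.1 (hu hb)⟩⟩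
      · refine ⟨hne, fun a ha b hb => ?_⟩
        rcases mem_coneTri.1 (hf ha) with h | h | h <;>
        rcases mem_coneTri.1 (hf hb) with h' | h' | h' <;>
        simp only [Inc, h, h'] <;>
        first
          | (refine ⟨f.1.1, ?_⟩; simp; done)
          | (refine ⟨f.1.2, ?_⟩; simp; done)
          | (refine ⟨w, ?_⟩; simp)
      · refine ⟨AttachTriangles.image_nonempty _, fun a ha b hb => ?_⟩
        set p := (triSet A w).equivFin.symm i
        rcases mem_image_triEdges.1 ha with h | h | h <;>
        rcases mem_image_triEdges.1 hb with h' | h' | h' <;>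
        simp only [Inc, h, h'] <;>
        first
          | (refine ⟨p.1.1, ?_⟩; simp; done)
          | (refine ⟨p.1.2.1, ?_⟩; simp; done)
          | (refine ⟨p.1.2.2, ?_⟩; simp)
  not_mem i := by
    set p := (triSet A w).equivFin.symm i
    have h := mem_triSet.1 p.2
    have hmem : ∀ j, triEdges p j ∈ univ.image (triEdges p) := fun j => by simp
    rintro ⟨-, ⟨u, hu⟩ | ⟨f, hf, hs⟩⟩
    · have h0 := mem_star.1 (hu (hmem 0))
      have h1 := mem_star.1 (hu (hmem 1))
      have h2 := mem_star.1 (hu (hmem 2))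
      simp [triEdges, Inc] at h0 h1 h2
      omega
    · have h1 := mem_coneTri.1 (hs (hmem 1))
      have h2 := mem_coneTri.1 (hs (hmem 2))
      have hz := (mem_erase.1 h.2.2.2).1
      simp [triEdges, Subtype.ext_iff, Prod.ext_iff] at h1 h2
      omega
  image_injective := by
    intro i j hij
    refine (triSet A w).equivFin.symm.injective ?_
    simp only at hij
    set p := (triSet A w).equivFin.symm i
    set q := (triSet A w).equivFin.symm j
    have hp := mem_triSet.1 p.2
    have hq := mem_triSet.1 q.2
    have hmem : ∀ k, triEdges p k ∈ univ.image (triEdges q) := fun k => by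
      rw [← hij]; simp
    have h0 := mem_image_triEdges.1 (hmem 0)
    have h1 := mem_image_triEdges.1 (hmem 1)
    have h2 := mem_image_triEdges.1 (hmem 2)
    simp [triEdges, Prod.ext_iff] at h0 h1 h2
    refine Subtype.ext (Prod.ext ?_ (Prod.ext ?_ ?_)) <;> omega

end Edge

namespace AbsSC

/-- An injection of the vertices which identifies the faces of `M` with those of `K` induces a
homeomorphism of realizations. -/
noncomputable def homeomorphOfEmbedding {V W : Type} [DecidableEq V] {K : AbsSC V} {M : AbsSC W}
    (β : W ↪ V) (hrange : ∀ s ∈ K.faces, ∀ v ∈ s, v ∈ Set.range β)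
    (hfaces : ∀ t : Finset W, t.map β ∈ K.faces ↔ t ∈ M.faces) : K.space ≃ₜ M.space where
  toFun x := ⟨fun u => x.1 (β u), fun u => x.2.1 _, by
    obtain ⟨s, hs, hx, hsum⟩ := x.2.2
    have hst : (s.preimage β β.injective.injOn).map β = s := by
      ext v
      simp only [mem_map, mem_preimage]
      constructor
      · rintro ⟨u, hu, rfl⟩
        exact hu
      · intro hv
        obtain ⟨u, rfl⟩ := hrange s hs v hv
        exact ⟨u, hv, rfl⟩
    refine ⟨s.preimage β β.injective.injOn, (hfaces _).1 (hst.symm ▸ hs),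
      fun u hu => mem_preimage.2 (hx _ hu), ?_⟩
    refine Eq.trans ?_ hsum
    conv_rhs => rw [← hst, sum_map]⟩
  invFun y := ⟨Function.extend β y.1 0, fun v => by
      by_cases hv : ∃ u, β u = v
      · obtain ⟨u, rfl⟩ := hv
        rw [β.injective.extend_apply]
        exact y.2.1 u
      · rw [Function.extend_apply' _ _ _ hv]
        exact le_rfl, by
    obtain ⟨t, ht, hy, hsum⟩ := y.2.2
    refine ⟨t.map β, (hfaces t).2 ht, fun v hv => ?_, ?_⟩
    · by_cases hv' : ∃ u, β u = v
      · obtain ⟨u, rfl⟩ := hv'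
        rw [β.injective.extend_apply] at hv
        exact mem_map_of_mem β (hy u hv)
      · exact (hv (Function.extend_apply' _ _ _ hv')).elim
    · rw [sum_map]
      refine Eq.trans (sum_congr rfl fun u _ => ?_) hsum
      exact β.injective.extend_apply _ _ _⟩
  left_inv x := by
    refine Subtype.ext (funext fun v => ?_)
    change Function.extend β (fun u => x.1 (β u)) 0 v = x.1 v
    by_cases hv : ∃ u, β u = v
    · obtain ⟨u, rfl⟩ := hv
      exact β.injective.extend_apply _ _ _
    · rw [Function.extend_apply' _ _ _ hv]
      obtain ⟨s, hs, hx⟩ := exists_carries x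
      by_contra h
      exact hv (hrange s hs v (hx v (Ne.symm h)))
  right_inv y := Subtype.ext (funext fun u => β.injective.extend_apply _ _ _)
  continuous_toFun := continuous_of_coord fun u => continuous_coord (β u)
  continuous_invFun := continuous_of_coord fun v => by
    change Continuous fun y : M.space => Function.extend β y.1 0 v
    by_cases hv : ∃ u, β u = v
    · obtain ⟨u, rfl⟩ := hv
      simp only [β.injective.extend_apply]
      exact continuous_coord u
    · simp only [Function.extend_apply' _ _ _ hv]
      exact continuous_const

end AbsSC

lemma List.lex_of_sortedLT {y : ℕ} : ∀ {l₁ l₂ : List ℕ}, l₁.Pairwise (· < ·) →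
    l₂.Pairwise (· < ·) → l₁.length = l₂.length → y ∈ l₁ → y ∉ l₂ →
    (∀ z < y, z ∈ l₁ ↔ z ∈ l₂) → List.Lex (· < ·) l₁ l₂
  | [], _, _, _, _, hy, _, _ => by simp at hy
  | _ :: _, [], _, _, h, _, _, _ => by simp at h
  | a :: t₁, b :: t₂, h₁, h₂, hl, hy, hy', hz => by
    rw [List.pairwise_cons] at h₁ h₂
    rcases lt_trichotomy a b with hab | rfl | hab
    · exact .rel hab
    · refine .cons (List.lex_of_sortedLT (y := y) h₁.2 h₂.2 (by simpa using hl) ?_ ?_ ?_)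
      · rcases List.mem_cons.1 hy with rfl | h
        · simp at hy'
        · exact h
      · exact fun h => hy' (List.mem_cons_of_mem _ h)
      · intro z hzy
        have h := hz z hzy
        simp only [List.mem_cons] at h
        constructor <;> intro hm
        · exact (h.1 (Or.inr hm)).resolve_left (h₁.1 z hm).ne'
        · exact (h.2 (Or.inr hm)).resolve_left (h₂.1 z hm).ne'
    · have hay : a ≤ y := by
        rcases List.mem_cons.1 hy with rfl | h
        exacts [le_rfl, (h₁.1 y h).le]
      rcases List.mem_cons.1 ((hz b (hab.trans_le hay)).2 (by simp)) with rfl | h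
      · exact (lt_irrefl _ hab).elim
      · exact (lt_asymm hab (h₁.1 b h)).elim

lemma lex_sort_of_mem {A B : Finset ℕ} {y : ℕ} (hc : A.card = B.card) (hy : y ∈ A) (hy' : y ∉ B)
    (hz : ∀ z < y, z ∈ A ↔ z ∈ B) :
    List.Lex (· < ·) (A.sort (· ≤ ·)) (B.sort (· ≤ ·)) := by
  refine List.lex_of_sortedLT (y := y) ?_ ?_ (by simpa using hc) (by simpa using hy)
    (by simpa using hy') (by simpa using hz)
  · exact A.sortedLT_sort.pairwise
  · exact B.sortedLT_sort.pairwise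

lemma precLT_asymm {A B : Finset ℕ} (h : precLT A B) (h' : precLT B A) : False := by
  rcases h with h | ⟨h, hl⟩ <;> rcases h' with h' | ⟨h', hl'⟩
  · omega
  · omega
  · omega
  · exact lt_asymm (α := List ℕ) hl hl'

/-- Of two sets that differ in at most two elements, the one that contains the larger element of
their symmetric difference is the larger one. -/
lemma precLT_symmDiff_pair {A : Finset ℕ} {y x : ℕ} (hyx : y < x) (hx : x ∈ A) :
    precLT (symmDiff A {y, x}) A := by
  by_cases hy : y ∈ A
  · refine Or.inl (card_lt_card ⟨fun z hz => ?_, fun h => ?_⟩)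
    · simp only [mem_symmDiff, mem_insert, mem_singleton] at hz
      grind
    · have := h hx
      simp [mem_symmDiff, hx] at this
  · have hs : symmDiff A {y, x} = insert y (A.erase x) := by
      ext z
      simp only [mem_symmDiff, mem_insert, mem_singleton, mem_erase]
      grind
    have hc : (symmDiff A {y, x}).card = A.card := by
      rw [hs, card_insert_of_notMem (by simp [hy]), card_erase_add_one hx]
    refine Or.inr ⟨hc, lex_sort_of_mem (y := y) hc ?_ hy fun z hz => ?_⟩
    · simp [mem_symmDiff, hy]
    · rw [hs, mem_insert, mem_erase]
      grind

lemma precLT_symmDiff_singleton {A : Finset ℕ} {x : ℕ} (hx : x ∈ A) :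
    precLT (symmDiff A {x}) A := by
  refine Or.inl (card_lt_card ⟨fun z hz => ?_, fun h => ?_⟩)
  · simp only [mem_symmDiff, mem_singleton] at hz
    grind
  · have := h hx
    simp [mem_symmDiff, hx] at this

namespace Edge

open AbsSC

variable {A : Finset ℕ}

/-- The nonzero endpoints of an edge. -/
def supp (e : Edge A) : Finset ℕ := ({e.1.1, e.1.2} : Finset ℕ).erase 0

lemma mem_supp {e : Edge A} {z : ℕ} : z ∈ e.supp ↔ z ≠ 0 ∧ Inc z e := by
  simp [supp, Inc]

lemma card_supp_le (e : Edge A) : e.supp.card ≤ 2 :=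
  (card_le_card (erase_subset _ _)).trans card_le_two

lemma supp_nonempty (e : Edge A) : e.supp.Nonempty :=
  ⟨e.1.2, mem_supp.2 ⟨by have := e.lt; omega, Or.inr rfl⟩⟩

lemma supp_injective : Function.Injective (supp : Edge A → Finset ℕ) := by
  intro e f h
  have he := e.lt
  have hf := f.lt
  have h' : ∀ z, z ≠ 0 → (Inc z e ↔ Inc z f) := fun z hz => by
    have := congrArg (z ∈ ·) h
    simpa [mem_supp, hz] using this
  simp only [Inc] at h'
  have h1 := h' e.1.1
  have h2 := h' e.1.2
  have h3 := h' f.1.1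
  have h4 := h' f.1.2
  exact Subtype.ext (Prod.ext (by omega) (by omega))

lemma card_symmDiff_supp_le_iff {e f : Edge A} :
    (symmDiff e.supp f.supp).card ≤ 2 ↔ ∃ u, Inc u e ∧ Inc u f := by
  have he := e.lt
  have hf := f.lt
  constructor
  · intro h
    by_contra! hne
    simp only [Inc] at hne
    have h1 := hne e.1.1
    have h2 := hne e.1.2
    obtain ⟨r, hr, hr1, hr2, hr3⟩ : ∃ r, r ≠ 0 ∧ (r = e.1.1 ∨ r = f.1.1) ∧ r ≠ e.1.2 ∧
        r ≠ f.1.2 := by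
      by_cases h0 : e.1.1 = 0
      · exact ⟨f.1.1, by omega, Or.inr rfl, by omega, by omega⟩
      · exact ⟨e.1.1, by omega, Or.inl rfl, by omega, by omega⟩
    have hsub : ({r, e.1.2, f.1.2} : Finset ℕ) ⊆ symmDiff e.supp f.supp := by
      intro z hz
      simp only [mem_insert, mem_singleton] at hz
      simp only [mem_symmDiff, mem_supp, Inc]
      omega
    have hc : ({r, e.1.2, f.1.2} : Finset ℕ).card = 3 :=
      card_eq_three.2 ⟨_, _, _, hr2, hr3, by omega, rfl⟩
    have := card_le_card hsub
    omega
  · rintro ⟨u, hu⟩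
    obtain ⟨p, q, hpq⟩ : ∃ p q, ∀ z, (Inc z e ↔ z = u ∨ z = p) ∧ (Inc z f ↔ z = u ∨ z = q) := by
      simp only [Inc] at hu ⊢
      rcases hu with ⟨rfl | rfl, h | h⟩
      · exact ⟨e.1.2, f.1.2, fun z => by omega⟩
      · exact ⟨e.1.2, f.1.1, fun z => by omega⟩
      · exact ⟨e.1.1, f.1.2, fun z => by omega⟩
      · exact ⟨e.1.1, f.1.1, fun z => by omega⟩
    refine (card_le_card (t := {p, q}) fun z hz => ?_).trans card_le_two
    simp only [mem_symmDiff, mem_supp, (hpq z).1, (hpq z).2] at hz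
    simp only [mem_insert, mem_singleton]
    omega

/-- An edge determines the set which differs from `A` in the nonzero endpoints of the edge. -/
def toSet : Edge A ↪ Finset ℕ where
  toFun e := symmDiff A e.supp
  inj' _ _ h := supp_injective (symmDiff_right_injective A h)

lemma symmDiff_toSet (e : Edge A) : symmDiff A (toSet e) = e.supp :=
  symmDiff_symmDiff_cancel_left _ _

lemma symmDiff_toSet_toSet (e f : Edge A) :
    symmDiff (toSet e) (toSet f) = symmDiff e.supp f.supp := by
  change symmDiff (symmDiff A e.supp) (symmDiff A f.supp) = _
  rw [symmDiff_symmDiff_symmDiff_comm, symmDiff_self, bot_symmDiff]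

lemma toSet_ne (e : Edge A) : toSet e ≠ A := by
  intro h
  have := symmDiff_toSet e
  rw [h, symmDiff_self] at this
  exact e.supp_nonempty.ne_empty this.symm

lemma toSet_mem_FprecLE {m : ℕ} (hAm : A ⊆ Icc 1 m) (e : Edge A) : toSet e ∈ FprecLE m A := by
  have hlt := e.lt
  have hm := mem_Icc.1 (hAm e.snd_mem)
  constructor
  · intro z hz
    rcases mem_symmDiff.1 hz with h | h
    · exact hAm h.1
    · have := mem_supp.1 h.1
      simp only [Inc] at this
      rw [mem_Icc]
      omega
  · refine Or.inl ?_
    change precLT (symmDiff A e.supp) A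
    by_cases h0 : e.1.1 = 0
    · have : e.supp = {e.1.2} := by
        ext z
        simp only [mem_supp, Inc, mem_singleton]
        omega
      rw [this]
      exact precLT_symmDiff_singleton e.snd_mem
    · have : e.supp = {e.1.1, e.1.2} := by
        ext z
        simp only [mem_supp, Inc, mem_singleton, mem_insert]
        omega
      rw [this]
      exact precLT_symmDiff_pair hlt e.snd_mem

lemma exists_toSet_eq {m : ℕ} (hAm : A ⊆ Icc 1 m) {B : Finset ℕ} (hB : B ∈ FprecLE m A)
    (hne : B ≠ A) (hd : (symmDiff A B).card ≤ 2) : ∃ e : Edge A, toSet e = B := by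
  have hlt : precLT B A := hB.2.resolve_right hne
  have hsub : ∀ z ∈ symmDiff A B, z ≠ 0 := by
    intro z hz
    have : z ∈ Icc 1 m := by
      rcases mem_symmDiff.1 hz with h | h
      exacts [hAm h.1, hB.1 h.1]
    have := mem_Icc.1 this
    omega
  have hBD : ∀ e : Edge A, e.supp = symmDiff A B → toSet e = B := by
    intro e he
    change symmDiff A e.supp = B
    rw [he, symmDiff_symmDiff_cancel_left]
  have hpos : 0 < (symmDiff A B).card := by
    rw [card_pos, nonempty_iff_ne_empty]
    exact fun h => hne (symmDiff_eq_bot.1 h).symm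
  have hAB : A = symmDiff B (symmDiff A B) := by
    rw [symmDiff_comm A B, symmDiff_symmDiff_cancel_left]
  obtain hc | hc : (symmDiff A B).card = 1 ∨ (symmDiff A B).card = 2 := by omega
  · obtain ⟨x, hx⟩ := card_eq_one.1 hc
    have hx0 := hsub x (by simp [hx])
    have hxA : x ∈ A := by
      by_contra h
      have hxB : x ∈ B := by
        have : x ∈ symmDiff A B := by simp [hx]
        rw [mem_symmDiff] at this
        tauto
      refine precLT_asymm hlt ?_
      have := precLT_symmDiff_singleton hxB
      rwa [← hx, ← hAB] at this
    refine ⟨⟨(0, x), mem_edgeSet.2 ⟨by omega, hxA⟩⟩, hBD _ ?_⟩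
    rw [hx]
    ext z
    simp only [mem_supp, Inc, mem_singleton]
    omega
  · obtain ⟨y, x, hyx, hx⟩ : ∃ y x, y < x ∧ symmDiff A B = {y, x} := by
      obtain ⟨y, x, hyx, hx⟩ := card_eq_two.1 hc
      rcases lt_or_gt_of_ne hyx with h | h
      · exact ⟨y, x, h, hx⟩
      · exact ⟨x, y, h, hx.trans (pair_comm _ _)⟩
    have hy0 := hsub y (by simp [hx])
    have hxA : x ∈ A := by
      by_contra h
      have hxB : x ∈ B := by
        have : x ∈ symmDiff A B := by simp [hx]
        rw [mem_symmDiff] at this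
        tauto
      refine precLT_asymm hlt ?_
      have := precLT_symmDiff_pair hyx hxB
      rwa [← hx, ← hAB] at this
    refine ⟨⟨(y, x), mem_edgeSet.2 ⟨hyx, hxA⟩⟩, hBD _ ?_⟩
    rw [hx]
    ext z
    simp only [mem_supp, Inc, mem_singleton, mem_insert]
    omega

/-- The link of `A` among the sets preceding `A` is the complex of pairwise intersecting edges. -/
noncomputable def linkHomeomorph {m : ℕ} (hAm : A ⊆ Icc 1 m) :
    ((VRc (FprecLE m A) 2).link A).space ≃ₜ (shareComplex A).space :=
  homeomorphOfEmbedding toSet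
    (by
      rintro s ⟨-, hA, -, hF, hd⟩ B hB
      exact exists_toSet_eq hAm (hF B (mem_union_left _ hB)) (fun h => hA (h ▸ hB))
        (hd A (by simp) B (mem_union_left _ hB)))
    (by
      intro t
      constructor
      · rintro ⟨hne, -, -, -, hd⟩
        refine ⟨fun h => hne (by simp [h]), fun a ha b hb => ?_⟩
        rw [← card_symmDiff_supp_le_iff, ← symmDiff_toSet_toSet]
        exact hd _ (mem_union_left _ (mem_map_of_mem _ ha)) _
          (mem_union_left _ (mem_map_of_mem _ hb))
      · rintro ⟨hne, h⟩
        refine ⟨fun h => hne (map_eq_empty.1 h), fun h => ?_, ⟨A, by simp⟩, ?_, ?_⟩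
        · obtain ⟨e, -, he⟩ := mem_map.1 h
          exact toSet_ne e he
        · intro B hB
          rcases mem_union.1 hB with hB | hB
          · obtain ⟨e, -, rfl⟩ := mem_map.1 hB
            exact toSet_mem_FprecLE hAm e
          · rw [mem_singleton.1 hB]
            exact ⟨hAm, Or.inr rfl⟩
        · have hA : ∀ e : Edge A, (symmDiff A (toSet e)).card ≤ 2 := fun e => by
            rw [symmDiff_toSet]
            exact card_supp_le e
          intro B hB C hC
          rcases mem_union.1 hB with hB | hB <;> rcases mem_union.1 hC with hC | hC
          · obtain ⟨e, he, rfl⟩ := mem_map.1 hB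
            obtain ⟨f, hf, rfl⟩ := mem_map.1 hC
            rw [symmDiff_toSet_toSet, card_symmDiff_supp_le_iff]
            exact h e he f hf
          · obtain ⟨e, he, rfl⟩ := mem_map.1 hB
            rw [mem_singleton.1 hC, symmDiff_comm]
            exact hA e
          · obtain ⟨f, hf, rfl⟩ := mem_map.1 hC
            rw [mem_singleton.1 hB]
            exact hA f
          · rw [mem_singleton.1 hB, mem_singleton.1 hC, symmDiff_self]
            simp)

lemma hEquivTop_link {m w : ℕ} (hAm : A ⊆ Icc 1 m) (hw : ∀ x ∈ A, x ≤ w) (hwA : w ∈ A) :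
    ((VRc (FprecLE m A) 2).link A).HEquivTop (WedgeSph 2 (triSet A w).card) := by
  have := contractibleSpace_coneComplex hw hwA (by have := mem_Icc.1 (hAm hwA); omega)
  obtain ⟨h⟩ := (attachTriangles hw).hEquivTop_wedgeSph
  exact ⟨(linkHomeomorph hAm).toHomotopyEquiv.trans h⟩

end Edge

/-- Summation by parts for the gaps of a sequence weighted by binomial coefficients. -/
lemma sum_gap_mul_choose (N : ℕ) (v : ℕ → ℤ) :
    (∑ k ∈ range (N + 1), (k.choose 2 : ℤ)) +
      ∑ j ∈ range N, (v (j + 1) - (v j + 1)) * ((N + 1 - j).choose 2 : ℤ) =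
    ∑ j ∈ range N, v (j + 1) * ((N - j : ℕ) : ℤ) - (v 0 + 1) * ((N + 1).choose 2 : ℤ) := by
  induction N generalizing v with
  | zero => simp
  | succ N ih =>
    have h := ih fun j => v (j + 1)
    have hc : ((N + 2).choose 2 : ℤ) = (N + 1 : ℤ) + ((N + 1).choose 2 : ℤ) := by
      rw [Nat.choose_succ_succ' (N + 1) 1]
      simp
    rw [sum_range_succ _ (N + 1), sum_range_succ' (fun j => v (j + 1) * _),
      sum_range_succ' (fun j => (v (j + 1) - (v j + 1)) * _)]
    simp only [Nat.add_sub_add_right, Nat.sub_zero, zero_add] at h ⊢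
    rw [show N + 1 + 1 = N + 2 from rfl, hc]
    push_cast
    linarith

namespace Edge

lemma card_triSet (A : Finset ℕ) (w : ℕ) : (triSet A w).card =
    ∑ x ∈ A.erase w, x * ((A.erase w).filter fun z => x < z).card := by
  rw [triSet, card_biUnion]
  · rw [sum_filter, sum_product]
    refine sum_congr rfl fun x _ => ?_
    rw [← sum_filter, mul_comm, ← smul_eq_mul, ← sum_const]
    refine sum_congr rfl fun z _ => ?_
    rw [card_image_of_injective _ (Prod.mk_left_injective _), card_range]
  · intro p _ q _ hpq
    rw [Function.onFun_apply, Finset.disjoint_left]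
    intro t ht ht'
    obtain ⟨y, -, rfl⟩ := mem_image.1 ht
    obtain ⟨y', -, h⟩ := mem_image.1 ht'
    exact hpq (Prod.ext_iff.1 h).2.symm

lemma card_triSet_of_strictMono {N : ℕ} {i : Fin (N + 2) → ℕ} (hi : StrictMono i) :
    (triSet (image i univ) (i (Fin.last _))).card = ∑ j ∈ range N, ith i j * (N - j) := by
  have hA : (image i univ).erase (i (Fin.last _)) =
      (univ : Finset (Fin (N + 1))).map (Fin.castSuccEmb.trans ⟨i, hi.injective⟩) := by
    rw [← image_erase hi.injective, map_eq_image]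
    ext x
    simp only [mem_image, mem_erase, mem_univ, and_true, true_and]
    constructor
    · rintro ⟨a, ha, rfl⟩
      exact ⟨a.castPred ha, by simp⟩
    · rintro ⟨a, rfl⟩
      exact ⟨a.castSucc, (Fin.castSucc_lt_last a).ne, rfl⟩
  have hfilter : ∀ j : Fin (N + 1),
      (univ.filter fun k : Fin (N + 1) => i j.castSucc < i k.castSucc) = Ioi j := by
    intro j
    ext k
    simp [hi.lt_iff_lt]
  have hj : ∀ j : Fin (N + 1), i j.castSucc * (Ioi j).card = ith i j * (N - j) := by
    intro j
    rw [Fin.card_Ioi, ith, dif_pos (j.2.trans (Nat.lt_succ_self _))]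
    rfl
  rw [card_triSet, hA, sum_map]
  refine (sum_congr rfl fun j _ => ?_).trans ((Fin.sum_univ_eq_sum_range
    (fun j => ith i j * (N - j)) (N + 1)).trans (by rw [sum_range_succ]; simp))
  rw [filter_map, card_map, ← hj, ← hfilter]
  rfl

end Edge

lemma sum_choose_add_toNat {N : ℕ} {i : Fin (N + 2) → ℕ} (hi : StrictMono i) :
    (∑ k ∈ Icc 2 N, Nat.choose k 2) +
      (∑ ℓ ∈ Icc 1 N, (ivZ i ℓ - (ivZ i (ℓ - 1) + 1)) * ((N + 2 - ℓ).choose 2 : ℤ)).toNat =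
    ∑ j ∈ range N, ith i j * (N - j) := by
  have h1 : ∑ k ∈ Icc 2 N, Nat.choose k 2 = ∑ k ∈ range (N + 1), Nat.choose k 2 := by
    refine sum_subset (fun k hk => ?_) fun k hk hk' => Nat.choose_eq_zero_of_lt ?_
    · rw [mem_Icc] at hk
      rw [mem_range]
      omega
    · rw [mem_range] at hk
      rw [mem_Icc] at hk'
      omega
  have h2 : ∑ ℓ ∈ Icc 1 N, (ivZ i ℓ - (ivZ i (ℓ - 1) + 1)) * ((N + 2 - ℓ).choose 2 : ℤ) =
      ∑ j ∈ range N, (ivZ i (j + 1) - (ivZ i j + 1)) * ((N + 1 - j).choose 2 : ℤ) := by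
    refine Eq.trans ?_ ((sum_Ico_add' (fun ℓ => (ivZ i ℓ - (ivZ i (ℓ - 1) + 1)) *
      ((N + 2 - ℓ).choose 2 : ℤ)) 0 N 1).symm.trans ?_)
    · rfl
    · rw [range_eq_Ico]
      refine sum_congr rfl fun j _ => ?_
      rw [show N + 2 - (j + 1) = N + 1 - j by omega, Nat.add_sub_cancel]
  have h3 : 0 ≤ ∑ j ∈ range N, (ivZ i (j + 1) - (ivZ i j + 1)) * ((N + 1 - j).choose 2 : ℤ) := by
    refine sum_nonneg fun j hj => mul_nonneg ?_ (Nat.cast_nonneg _)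
    rw [mem_range] at hj
    rcases j with _ | j
    · simp [ivZ]
    · have h : ith i j < ith i (j + 1) := by
        simp only [ith, show j < N + 2 by omega, show j + 1 < N + 2 by omega, dif_pos]
        exact hi (Fin.mk_lt_mk.2 (Nat.lt_succ_self j))
      simp only [ivZ, Nat.succ_ne_zero, if_false, Nat.add_sub_cancel]
      omega
  zify
  rw [h2, Int.toNat_of_nonneg h3]
  have h := sum_gap_mul_choose N (ivZ i)
  have h1' := congrArg (Nat.cast : ℕ → ℤ) h1
  push_cast at h1'
  rw [h1', h]
  simp [ivZ]

/-- For `m ≥ n > 2` and `A = i_1 i_2 ⋯ i_n ⊆ [m]`, with `i_0 = -1` and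
`d_ℓ = i_ℓ - (i_{ℓ-1} + 1)`, the link of the vertex `A` in `VR(F^m_{⪯A}, 2)` is homotopy
equivalent to a wedge of `Σ_{k=2}^{n-2} C(k,2) + Σ_{ℓ=1}^{n-2} d_ℓ·C(n-ℓ,2)` copies of `S²`. -/
theorem stmt12 (m n : ℕ) (hn : 2 < n) (hnm : n ≤ m)
    (A : Finset ℕ) (hAm : A ⊆ Finset.Icc 1 m)
    (i : Fin n → ℕ) (hmono : StrictMono i) (hAi : A = Finset.image i Finset.univ) :
    AbsSC.HEquivTop ((VRc (FprecLE m A) 2).link A)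
      (WedgeSph 2 ((∑ k ∈ Finset.Icc 2 (n - 2), Nat.choose k 2) +
        (∑ ℓ ∈ Finset.Icc 1 (n - 2),
          (ivZ i ℓ - (ivZ i (ℓ - 1) + 1)) * ((n - ℓ).choose 2 : ℤ)).toNat)) := by
  obtain ⟨N, rfl⟩ : ∃ N, n = N + 2 := ⟨n - 2, by omega⟩
  rw [Nat.add_sub_cancel, sum_choose_add_toNat hmono, ← Edge.card_triSet_of_strictMono hmono,
    ← hAi]
  refine Edge.hEquivTop_link hAm (fun x hx => ?_) ?_
  · rw [hAi] at hx
    obtain ⟨j, -, rfl⟩ := mem_image.1 hx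
    exact hmono.monotone (Fin.le_last j)
  · rw [hAi]
    exact mem_image_of_mem _ (mem_univ _)
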